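/- arXiv:math/0409202 — 3 statements merged into one kernel-verified Lean document; each statement's English description precedes it below -/
import Mathlib

section
/- Let G be a finite group with center Z, and let Q_1,…,Q_n be distinct conjugacy classes of G such that Q = Q_1 ∪ ⋯ ∪ Q_n generates G and Z·Q_i = Q_i for each i = 1,…,n; regard Q as a rack with x^y = y⁻¹xy. Let A = ℚ⟦h⟧ and m = (h). Then: (i) every Yang-Baxter deformation of c_Q with respect to m is equivalent to a deformation c of the form c(x ⊗ y) = Σ_{(z,z′) ∈ Z×Z} λ_{ij}(z,z′) · (zy) ⊗ (z′·y⁻¹xy) for x ∈ Q_i and y ∈ Q_j, where the coefficient functions λ_{ij}: Z × Z → ℚ⟦h⟧ satisfy λ_{ij}(1,1) ≡ 1 mod (h) and λ_{ij}(z,z′) ≡ 0 mod (h) for (z,z′) ≠ (1,1); (ii) conversely, every A-linear map c of this form is a Yang-Baxter operator. -/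
open TensorProduct

noncomputable section

/-- A rack: a set with a binary operation `act x y = x ^ y` such that all right
translations are bijective and the operation is right self-distributive. -/
structure YBRack (Q : Type*) where
  act : Q → Q → Q
  act_bijective : ∀ y : Q, Function.Bijective fun x => act x y
  self_distrib : ∀ x y z : Q, act (act x y) z = act (act x z) (act y z)

namespace YBRack

variable {Q : Type*} {A : Type*} [CommRing A]

/-- Right translation by `y` as a permutation of `Q`. -/
def rho (R : YBRack Q) (y : Q) : Equiv.Perm Q :=
  Equiv.ofBijective _ (R.act_bijective y)

/-- The inner automorphism group of a rack: the subgroup of `Perm Q` generated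
by all right translations. -/
def Inn (R : YBRack Q) : Subgroup (Equiv.Perm Q) :=
  Subgroup.closure (Set.range R.rho)

/-- Behavioural equivalence: `x ≡ y` iff `ϱ(x) = ϱ(y)`. -/
def BEquiv (R : YBRack Q) (x y : Q) : Prop := R.rho x = R.rho y

end YBRack
/-- Matrix of a linear endomorphism of `AQ ⊗ AQ`, via the identification of
`AQ ⊗ AQ` with the free module on `Q × Q`. -/
def mat2 (A : Type*) [CommRing A] {Q : Type*}
    (f : ((Q →₀ A) ⊗[A] (Q →₀ A)) →ₗ[A] ((Q →₀ A) ⊗[A] (Q →₀ A))) (p q : Q × Q) : A :=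
  finsuppTensorFinsupp' A Q Q (f ((finsuppTensorFinsupp' A Q Q).symm (Finsupp.single p 1))) q

/-- Matrix of a linear endomorphism of `AQ`. -/
def mat1 (A : Type*) [CommRing A] {Q : Type*}
    (f : (Q →₀ A) →ₗ[A] (Q →₀ A)) (x u : Q) : A :=
  f (Finsupp.single x 1) u

/-- The Yang–Baxter (braid) equation for an endomorphism of `M ⊗ M`, where
`c₁ = c ⊗ id` and `c₂ = id ⊗ c` act on `(M ⊗ M) ⊗ M`. -/
def YBE {A M : Type*} [CommRing A] [AddCommGroup M] [Module A M]
    (c : (M ⊗[A] M) →ₗ[A] (M ⊗[A] M)) : Prop :=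
  (LinearMap.rTensor M c) ∘ₗ
      ((TensorProduct.assoc A M M M).symm.toLinearMap ∘ₗ (LinearMap.lTensor M c) ∘ₗ
        (TensorProduct.assoc A M M M).toLinearMap) ∘ₗ (LinearMap.rTensor M c)
    = ((TensorProduct.assoc A M M M).symm.toLinearMap ∘ₗ (LinearMap.lTensor M c) ∘ₗ
        (TensorProduct.assoc A M M M).toLinearMap) ∘ₗ (LinearMap.rTensor M c) ∘ₗ
      ((TensorProduct.assoc A M M M).symm.toLinearMap ∘ₗ (LinearMap.lTensor M c) ∘ₗ
        (TensorProduct.assoc A M M M).toLinearMap)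

/-- A Yang–Baxter operator: a bijective linear endomorphism of `M ⊗ M`
satisfying the Yang–Baxter equation. -/
def IsYBOp {A M : Type*} [CommRing A] [AddCommGroup M] [Module A M]
    (c : (M ⊗[A] M) →ₗ[A] (M ⊗[A] M)) : Prop :=
  Function.Bijective c ∧ YBE c

/-- An endomorphism of `AQ ⊗ AQ` is entropic (with respect to the rack `R`)
if its matrix is quasi-diagonal and fully equivariant. -/
def Entropic2 {Q : Type*} (R : YBRack Q) (A : Type*) [CommRing A]
    (f : ((Q →₀ A) ⊗[A] (Q →₀ A)) →ₗ[A] ((Q →₀ A) ⊗[A] (Q →₀ A))) : Prop :=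
  (∀ x y u v : Q, (¬ R.BEquiv x u ∨ ¬ R.BEquiv y v) → mat2 A f (x, y) (u, v) = 0) ∧
  (∀ (x y u v : Q) (α β : R.Inn),
    mat2 A f ((α : Equiv.Perm Q) x, (β : Equiv.Perm Q) y)
        ((α : Equiv.Perm Q) u, (β : Equiv.Perm Q) v)
      = mat2 A f (x, y) (u, v))

open scoped Classical in
/-- Two Yang–Baxter operators are equivalent with respect to the ideal `m` if
they are conjugate by `α ⊗ α` for some automorphism `α` of `AQ` congruent to
the identity modulo `m`. -/
def YBEquivalent {Q A : Type*} [CommRing A] (m : Ideal A)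
    (c c' : ((Q →₀ A) ⊗[A] (Q →₀ A)) →ₗ[A] ((Q →₀ A) ⊗[A] (Q →₀ A))) : Prop :=
  ∃ α : (Q →₀ A) ≃ₗ[A] (Q →₀ A),
    (∀ x u : Q, (α (Finsupp.single x 1)) u - (if x = u then 1 else 0) ∈ m) ∧
    c' = (TensorProduct.congr α α).toLinearMap ∘ₗ c ∘ₗ (TensorProduct.congr α α).symm.toLinearMap

/-- A conjugacy class is closed under conjugation. -/
lemma conjClass_conj_mem {G : Type*} [Group G] {S : Set G} (h : ∃ g : G, S = {x | IsConj g x})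
    {x : G} (hx : x ∈ S) (y : G) : y⁻¹ * x * y ∈ S := by
  obtain ⟨g, rfl⟩ := h
  exact hx.trans (isConj_iff.mpr ⟨y⁻¹, by group⟩)

namespace YBRack

section Cocycle

variable {Q : Type*} (R : YBRack Q) {K : Type*}

lemma act_left_inj {x u y : Q} : R.act x y = R.act u y ↔ x = u :=
  (R.act_bijective y).injective.eq_iff

lemma bEquiv_iff {y v : Q} : R.BEquiv y v ↔ ∀ x, R.act x y = R.act x v := by
  constructor
  · intro h x
    exact congrArg (fun s : Equiv.Perm Q => s x) h
  · intro h
    exact Equiv.ext h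

lemma Inn_induction {p : Equiv.Perm Q → Prop} (one : p 1) (rho : ∀ z, p (R.rho z))
    (mul : ∀ g h, g ∈ R.Inn → h ∈ R.Inn → p g → p h → p (g * h))
    (inv : ∀ g, g ∈ R.Inn → p g → p g⁻¹) {g : Equiv.Perm Q} (hg : g ∈ R.Inn) : p g := by
  induction hg using Subgroup.closure_induction with
  | mem x hx => obtain ⟨z, rfl⟩ := hx; exact rho z
  | one => exact one
  | mul x y hx hy h1 h2 => exact mul x y hx hy h1 h2
  | inv x hx h => exact inv x hx h

lemma Inn_act {g : Equiv.Perm Q} (hg : g ∈ R.Inn) :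
    ∀ x y, g (R.act x y) = R.act (g x) (g y) := by
  refine R.Inn_induction (p := fun g => ∀ x y, g (R.act x y) = R.act (g x) (g y))
    ?_ ?_ ?_ ?_ hg
  · intro x y; rfl
  · intro z x y; exact R.self_distrib x y z
  · intro g h _ _ h1 h2 x y
    simp [h1, h2]
  · intro g _ h x y
    apply g.injective
    simp [h]

lemma Inn_bEquiv {g : Equiv.Perm Q} (hg : g ∈ R.Inn) {y v : Q} :
    R.BEquiv (g y) (g v) ↔ R.BEquiv y v := by
  simp only [bEquiv_iff]
  constructor
  · intro h x
    apply g.injective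
    rw [R.Inn_act hg, R.Inn_act hg, h]
  · intro h x
    obtain ⟨x, rfl⟩ := g.surjective x
    rw [← R.Inn_act hg, ← R.Inn_act hg, h]

variable [DecidableEq Q]

/-- The Yang–Baxter coboundary of a matrix `α`, that is, the matrix of
`c⁻¹ (α ⊗ 1 + 1 ⊗ α) c - (α ⊗ 1 + 1 ⊗ α)` for the braiding `c` of the rack. -/
def coboundary [Ring K] (α : Q → Q → K) (x y u v : Q) : K :=
  α y v * ((if R.act x y = R.act u v then 1 else 0) - if x = u then 1 else 0)
    + (if y = v then 1 else 0) * (α (R.act x y) (R.act u v) - α x u)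

/-- The infinitesimal Yang–Baxter equation at the braiding of the rack. -/
def IsCocycle [Ring K] (f : Q → Q → Q → Q → K) : Prop :=
  ∀ x y z u v w,
    f y z v w * ((if R.act (R.act x y) z = R.act (R.act u v) w then 1 else 0)
        - if x = u then 1 else 0)
      + (if y = v then 1 else 0) * f (R.act x y) z (R.act u v) w
      - f x z u w * (if R.act y z = R.act v w then 1 else 0)
      + (f x y u v - f (R.act x z) (R.act y z) (R.act u w) (R.act v w))
        * (if z = w then 1 else 0) = 0

/-- Quasi-diagonal and fully equivariant kernels on `Q × Q`. -/
structure IsEntropic [Zero K] (f : Q → Q → Q → Q → K) : Prop where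
  quasi_diagonal : ∀ x y u v, ¬ R.BEquiv x u ∨ ¬ R.BEquiv y v → f x y u v = 0
  equivariant : ∀ g ∈ R.Inn, ∀ k ∈ R.Inn, ∀ x y u v, f (g x) (k y) (g u) (k v) = f x y u v

variable {R}

lemma coboundary_comp [Ring K] {g : Equiv.Perm Q} (hg : g ∈ R.Inn) (α : Q → Q → K)
    (x y u v : Q) :
    R.coboundary α (g x) (g y) (g u) (g v)
      = R.coboundary (fun a b => α (g a) (g b)) x y u v := by
  simp only [coboundary, ← R.Inn_act hg, g.injective.eq_iff]

lemma IsCocycle.comp [Ring K] {f : Q → Q → Q → Q → K} (hf : R.IsCocycle f)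
    {g : Equiv.Perm Q} (hg : g ∈ R.Inn) :
    R.IsCocycle (fun x y u v => f (g x) (g y) (g u) (g v)) := by
  intro x y z u v w
  have := hf (g x) (g y) (g z) (g u) (g v) (g w)
  simp only [← R.Inn_act hg, g.injective.eq_iff] at this
  exact this

lemma IsCocycle.exists_coboundary_of_mem_Inn [CommRing K] {f : Q → Q → Q → Q → K}
    (hf : R.IsCocycle f) {g : Equiv.Perm Q} (hg : g ∈ R.Inn) :
    ∃ α : Q → Q → K, ∀ x y u v,
      f (g x) (g y) (g u) (g v) - f x y u v = R.coboundary α x y u v := by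
  refine R.Inn_induction (p := fun g => ∃ α : Q → Q → K, ∀ x y u v,
      f (g x) (g y) (g u) (g v) - f x y u v = R.coboundary α x y u v) ?_ ?_ ?_ ?_ hg
  · exact ⟨0, fun x y u v => by simp [coboundary]⟩
  · intro z
    refine ⟨fun a b => f a z b z, fun x y u v => ?_⟩
    have h := hf x y z u v z
    simp only [R.act_left_inj, if_true, mul_one] at h
    change f (R.act x z) (R.act y z) (R.act u z) (R.act v z) - _ = _
    rw [coboundary]
    linear_combination -h
  · rintro g k hg hk ⟨α, hα⟩ ⟨β, hβ⟩
    refine ⟨fun a b => α (k a) (k b) + β a b, fun x y u v => ?_⟩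
    have h1 := hα (k x) (k y) (k u) (k v)
    rw [coboundary_comp hk] at h1
    have h2 := hβ x y u v
    have : R.coboundary (fun a b => α (k a) (k b) + β a b) x y u v
        = R.coboundary (fun a b => α (k a) (k b)) x y u v + R.coboundary β x y u v := by
      simp only [coboundary]; noncomm_ring
    rw [this, ← h1, ← h2]
    simp
  · rintro g hg ⟨α, hα⟩
    refine ⟨fun a b => -α (g⁻¹ a) (g⁻¹ b), fun x y u v => ?_⟩
    have h1 := hα (g⁻¹ x) (g⁻¹ y) (g⁻¹ u) (g⁻¹ v)
    rw [coboundary_comp (inv_mem hg)] at h1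
    have : R.coboundary (fun a b => -α (g⁻¹ a) (g⁻¹ b)) x y u v
        = -R.coboundary (fun a b => α (g⁻¹ a) (g⁻¹ b)) x y u v := by
      simp only [coboundary]; noncomm_ring
    rw [this, ← h1]
    simp

lemma IsCocycle.exists_isEntropic_of_equivariant [CommRing K] {f : Q → Q → Q → Q → K}
    (hf : R.IsCocycle f)
    (hinv : ∀ g ∈ R.Inn, ∀ x y u v, f (g x) (g y) (g u) (g v) = f x y u v) :
    ∃ β : Q → Q → K, R.IsEntropic (fun x y u v => f x y u v - R.coboundary β x y u v) := by
  have mem_rho : ∀ z, R.rho z ∈ R.Inn := fun z => Subgroup.subset_closure ⟨z, rfl⟩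
  have hred : ∀ x y z u v w,
      f y z v w * ((if R.act (R.act x y) z = R.act (R.act u v) w then 1 else 0)
          - if x = u then 1 else 0)
        + (if y = v then 1 else 0) * f (R.act x y) z (R.act u v) w
        - f x z u w * (if R.act y z = R.act v w then 1 else 0) = 0 := by
    intro x y z u v w
    have h := hf x y z u v w
    by_cases hzw : z = w
    · subst hzw
      have h2 : f (R.act x z) (R.act y z) (R.act u z) (R.act v z) = f x y u v :=
        hinv _ (mem_rho z) x y u v
      rw [h2] at h
      simpa using h
    · simpa [hzw] using h
  have off : ∀ z w y v, y ≠ v → R.act y z = R.act v w → ∀ x u, f x z u w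
      = f y z v w * ((if R.act x z = R.act u w then 1 else 0) - if x = u then 1 else 0) := by
    intro z w y v hyv hyz x u
    have h := hred x y z u v w
    rw [R.self_distrib x y z, R.self_distrib u v w, ← hyz] at h
    simp only [R.act_left_inj, hyv, if_false, if_true] at h
    linear_combination -h
  have ex : ∀ z w, ¬ R.BEquiv z w → ∃ y v, y ≠ v ∧ R.act y z = R.act v w := by
    intro z w h
    rw [bEquiv_iff] at h
    push Not at h
    obtain ⟨y, hy⟩ := h
    obtain ⟨v, hv⟩ := (R.act_bijective w).surjective (R.act y z)
    refine ⟨y, v, ?_, hv.symm⟩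
    rintro rfl
    exact hy hv.symm
  have diag : ∀ z w, R.BEquiv z w → ∀ y v, ¬ R.BEquiv y v → f y z v w = 0 := by
    intro z w hzw y v hyv
    have hne : y ≠ v := by rintro rfl; exact hyv rfl
    rw [bEquiv_iff] at hzw hyv
    push Not at hyv
    obtain ⟨x, hx⟩ := hyv
    have h := hred x y z x v w
    simp only [hzw, R.act_left_inj, hne, hx, if_false, if_true] at h
    linear_combination -h
  have first : ∀ z w, R.BEquiv z w → ∀ g ∈ R.Inn, ∀ x u, f (g x) z (g u) w = f x z u w := by
    intro z w hzw g hg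
    refine R.Inn_induction (p := fun g => ∀ x u, f (g x) z (g u) w = f x z u w) ?_ ?_ ?_ ?_ hg
    · intro x u; rfl
    · intro y x u
      rw [bEquiv_iff] at hzw
      have h := hred x y z u y w
      simp only [hzw, R.act_left_inj, if_true] at h
      change f (R.act x y) z (R.act u y) w = _
      linear_combination h
    · intro g k _ _ h1 h2 x u
      simp [h1, h2]
    · intro g _ h x u
      have := h (g⁻¹ x) (g⁻¹ u)
      simpa using this.symm
  have exb : ∀ z w, ∃ b, (R.BEquiv z w → b = 0) ∧
      (∀ y v, ¬ R.BEquiv z w → y ≠ v → R.act y z = R.act v w → f y z v w = b) := by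
    intro z w
    by_cases h : R.BEquiv z w
    · exact ⟨0, fun _ => rfl, fun _ _ h' => absurd h h'⟩
    · obtain ⟨y, v, hyv, hyz⟩ := ex z w h
      refine ⟨f y z v w, fun h' => absurd h' h, fun y' v' _ hne he => ?_⟩
      rw [off z w y v hyv hyz y' v']
      simp [hne, he]
  choose β hβ0 hβ1 using exb
  have hβinv : ∀ g ∈ R.Inn, ∀ z w, β (g z) (g w) = β z w := by
    intro g hg z w
    by_cases h : R.BEquiv z w
    · rw [hβ0 _ _ h, hβ0 _ _ ((R.Inn_bEquiv hg).2 h)]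
    · obtain ⟨y, v, hyv, hyz⟩ := ex z w h
      rw [← hβ1 z w y v h hyv hyz, ← hβ1 (g z) (g w) (g y) (g v)
        (fun h' => h ((R.Inn_bEquiv hg).1 h')) (g.injective.ne hyv)
        (by rw [← R.Inn_act hg, ← R.Inn_act hg, hyz]), hinv g hg]
  have key : ∀ x y u v, f x y u v - R.coboundary β x y u v
      = f x y u v - β y v * ((if R.act x y = R.act u v then 1 else 0)
        - if x = u then 1 else 0) := by
    intro x y u v
    rw [coboundary]
    by_cases hyv : y = v
    · subst hyv
      have : β (R.act x y) (R.act u y) = β x u := hβinv _ (mem_rho y) x u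
      simp [this]
    · simp [hyv]
  have off0 : ∀ x y u v, ¬ R.BEquiv y v → f x y u v - R.coboundary β x y u v = 0 := by
    intro x y u v h
    obtain ⟨a, b, hab, h'⟩ := ex y v h
    rw [key, off y v a b hab h' x u, hβ1 y v a b h hab h', sub_self]
  have on0 : ∀ x y u v, R.BEquiv y v → f x y u v - R.coboundary β x y u v = f x y u v := by
    intro x y u v h
    rw [key, hβ0 y v h]; simp
  refine ⟨β, ⟨?_, ?_⟩⟩
  · intro x y u v h
    by_cases hyv : R.BEquiv y v
    · rw [on0 _ _ _ _ hyv]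
      exact diag _ _ hyv _ _ (h.resolve_right (not_not.2 hyv))
    · exact off0 _ _ _ _ hyv
  · intro g hg k hk x y u v
    by_cases hyv : R.BEquiv y v
    · have e := hinv k hk ((k⁻¹ * g) x) y ((k⁻¹ * g) u) v
      rw [first y v hyv _ (mul_mem (inv_mem hk) hg)] at e
      rw [on0 _ _ _ _ hyv, on0 _ _ _ _ ((R.Inn_bEquiv hk).2 hyv), ← e]
      simp
    · rw [off0 _ _ _ _ hyv, off0 _ _ _ _ (fun h => hyv ((R.Inn_bEquiv hk).1 h))]

/-- Every infinitesimal deformation of the braiding of a finite rack is cohomologous to an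
entropic one. -/
theorem IsCocycle.exists_isEntropic [Finite Q] [Field K] [CharZero K]
    {f : Q → Q → Q → Q → K} (hf : R.IsCocycle f) :
    ∃ β : Q → Q → K, R.IsEntropic (fun x y u v => f x y u v - R.coboundary β x y u v) := by
  classical
  have := Fintype.ofFinite R.Inn
  have hN : (Fintype.card R.Inn : K) ≠ 0 := Nat.cast_ne_zero.2 Fintype.card_ne_zero
  choose α hα using fun g : R.Inn => hf.exists_coboundary_of_mem_Inn g.2
  let N : K := (Fintype.card R.Inn : K)⁻¹
  let a : Q → Q → K := fun p q => N * ∑ g : R.Inn, α g p q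
  let f' : Q → Q → Q → Q → K := fun x y u v => N * ∑ g : R.Inn,
    f (g.1 x) (g.1 y) (g.1 u) (g.1 v)
  have hf' : ∀ x y u v, f' x y u v = f x y u v + R.coboundary a x y u v := by
    intro x y u v
    have h1 : R.coboundary a x y u v = N * ∑ g : R.Inn, R.coboundary (α g) x y u v := by
      simp only [coboundary, a, Finset.sum_add_distrib, ← Finset.sum_mul, ← Finset.mul_sum,
        Finset.sum_sub_distrib]
      ring
    have h2 : N * (Fintype.card R.Inn : K) = 1 := inv_mul_cancel₀ hN
    simp only [h1, ← hα, Finset.sum_sub_distrib, f', Finset.sum_const, Finset.card_univ,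
      nsmul_eq_mul]
    linear_combination (f x y u v) * h2
  have hcoc : R.IsCocycle f' := by
    intro x y z u v w
    have h := Finset.sum_congr rfl fun (g : R.Inn) (_ : g ∈ Finset.univ) =>
      (hf.comp g.2) x y z u v w
    simp only [Finset.sum_add_distrib, Finset.sum_sub_distrib, ← Finset.sum_mul,
      ← Finset.mul_sum, Finset.sum_const_zero] at h
    simp only [f']
    linear_combination N * h
  have hinv : ∀ g ∈ R.Inn, ∀ x y u v, f' (g x) (g y) (g u) (g v) = f' x y u v := by
    intro g hg x y u v
    simp only [f']
    congr 1
    exact Fintype.sum_equiv (Equiv.mulRight (⟨g, hg⟩ : R.Inn)) _ _ fun k => rfl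
  obtain ⟨β, hβ⟩ := hcoc.exists_isEntropic_of_equivariant hinv
  refine ⟨fun p q => β p q - a p q, ?_⟩
  convert hβ using 5
  rw [hf']
  simp only [coboundary]
  ring

end Cocycle

end YBRack

section MatrixForm

open scoped Kronecker
open Matrix

variable {Q A : Type*} [Fintype Q] [DecidableEq Q] [CommRing A]

/-- The action of a matrix on the first two factors of a triple tensor power. -/
def kron12 : Matrix (Q × Q) (Q × Q) A →ₐ[A] Matrix ((Q × Q) × Q) ((Q × Q) × Q) A :=
  AlgHom.ofLinearMap
    { toFun := fun M => M ⊗ₖ (1 : Matrix Q Q A)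
      map_add' := fun M N => add_kronecker M N 1
      map_smul' := fun r M => smul_kronecker r M 1 }
    one_kronecker_one
    (fun M N => by
      change (M * N) ⊗ₖ (1 : Matrix Q Q A) = (M ⊗ₖ (1 : Matrix Q Q A)) * (N ⊗ₖ (1 : Matrix Q Q A))
      rw [← mul_kronecker_mul, one_mul])

/-- The action of a matrix on the last two factors of a triple tensor power. -/
def kron23 : Matrix (Q × Q) (Q × Q) A →ₐ[A] Matrix ((Q × Q) × Q) ((Q × Q) × Q) A :=
  (reindexAlgEquiv A A (Equiv.prodAssoc Q Q Q).symm).toAlgHom.comp <|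
  AlgHom.ofLinearMap
    { toFun := fun M => (1 : Matrix Q Q A) ⊗ₖ M
      map_add' := fun M N => kronecker_add 1 M N
      map_smul' := fun r M => kronecker_smul r 1 M }
    one_kronecker_one
    (fun M N => by
      change (1 : Matrix Q Q A) ⊗ₖ (M * N) = ((1 : Matrix Q Q A) ⊗ₖ M) * ((1 : Matrix Q Q A) ⊗ₖ N)
      rw [← mul_kronecker_mul, one_mul])

lemma kron12_apply (M : Matrix (Q × Q) (Q × Q) A) (x y z u v w : Q) :
    kron12 M ((u, v), w) ((x, y), z) = M (u, v) (x, y) * if z = w then 1 else 0 := by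
  change (M ⊗ₖ (1 : Matrix Q Q A)) ((u, v), w) ((x, y), z) = _
  simp only [kroneckerMap_apply, one_apply, eq_comm]

lemma kron23_apply (M : Matrix (Q × Q) (Q × Q) A) (x y z u v w : Q) :
    kron23 M ((u, v), w) ((x, y), z) = (if x = u then 1 else 0) * M (v, w) (y, z) := by
  change ((1 : Matrix Q Q A) ⊗ₖ M) (u, (v, w)) (x, (y, z)) = _
  simp only [kroneckerMap_apply, one_apply, eq_comm]

/-- The Yang–Baxter equation in matrix form. -/
def MatYBE (M : Matrix (Q × Q) (Q × Q) A) : Prop :=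
  kron12 M * kron23 M * kron12 M = kron23 M * kron12 M * kron23 M

lemma kron12_map {B : Type*} [CommRing B] (π : A →+* B) (M : Matrix (Q × Q) (Q × Q) A) :
    kron12 (M.map π) = (kron12 M).map π := by
  ext ⟨⟨u, v⟩, w⟩ ⟨⟨x, y⟩, z⟩
  by_cases h : z = w <;> simp [kron12_apply, h]

lemma kron23_map {B : Type*} [CommRing B] (π : A →+* B) (M : Matrix (Q × Q) (Q × Q) A) :
    kron23 (M.map π) = (kron23 M).map π := by
  ext ⟨⟨u, v⟩, w⟩ ⟨⟨x, y⟩, z⟩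
  by_cases h : x = u <;> simp [kron23_apply, h]

lemma kron12_mul_kronecker (M : Matrix (Q × Q) (Q × Q) A) (a : Matrix Q Q A) :
    kron12 M * ((a ⊗ₖ a) ⊗ₖ a) = (M * (a ⊗ₖ a)) ⊗ₖ a := by
  change (M ⊗ₖ (1 : Matrix Q Q A)) * _ = _
  rw [← mul_kronecker_mul, one_mul]

lemma kronecker_mul_kron12 (M : Matrix (Q × Q) (Q × Q) A) (a : Matrix Q Q A) :
    ((a ⊗ₖ a) ⊗ₖ a) * kron12 M = ((a ⊗ₖ a) * M) ⊗ₖ a := by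
  change _ * (M ⊗ₖ (1 : Matrix Q Q A)) = _
  rw [← mul_kronecker_mul, mul_one]

lemma kron23_mul_kronecker (M : Matrix (Q × Q) (Q × Q) A) (a : Matrix Q Q A) :
    kron23 M * ((a ⊗ₖ a) ⊗ₖ a)
      = reindexAlgEquiv A A (Equiv.prodAssoc Q Q Q).symm (a ⊗ₖ (M * (a ⊗ₖ a))) := by
  have h : (a ⊗ₖ a) ⊗ₖ a
      = reindexAlgEquiv A A (Equiv.prodAssoc Q Q Q).symm (a ⊗ₖ (a ⊗ₖ a)) := by
    ext ⟨⟨x, y⟩, z⟩ ⟨⟨u, v⟩, w⟩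
    simp [kroneckerMap_apply, mul_assoc]
  change reindexAlgEquiv A A (Equiv.prodAssoc Q Q Q).symm ((1 : Matrix Q Q A) ⊗ₖ M) * _ = _
  rw [h, ← map_mul, ← mul_kronecker_mul, one_mul]

lemma kronecker_mul_kron23 (M : Matrix (Q × Q) (Q × Q) A) (a : Matrix Q Q A) :
    ((a ⊗ₖ a) ⊗ₖ a) * kron23 M
      = reindexAlgEquiv A A (Equiv.prodAssoc Q Q Q).symm (a ⊗ₖ ((a ⊗ₖ a) * M)) := by
  have h : (a ⊗ₖ a) ⊗ₖ a
      = reindexAlgEquiv A A (Equiv.prodAssoc Q Q Q).symm (a ⊗ₖ (a ⊗ₖ a)) := by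
    ext ⟨⟨x, y⟩, z⟩ ⟨⟨u, v⟩, w⟩
    simp [kroneckerMap_apply, mul_assoc]
  change _ * reindexAlgEquiv A A (Equiv.prodAssoc Q Q Q).symm ((1 : Matrix Q Q A) ⊗ₖ M) = _
  rw [h, ← map_mul, ← mul_kronecker_mul, mul_one]

lemma MatYBE.conj {M N : Matrix (Q × Q) (Q × Q) A} (hM : MatYBE M) {a : Matrix Q Q A}
    (ha : IsUnit a) (h : M * (a ⊗ₖ a) = (a ⊗ₖ a) * N) : MatYBE N := by
  obtain ⟨b, hba⟩ := ha.exists_left_inv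
  have h3 : ((b ⊗ₖ b) ⊗ₖ b) * ((a ⊗ₖ a) ⊗ₖ a) = 1 := by
    simp only [← mul_kronecker_mul, hba, one_kronecker_one]
  have h12 : kron12 M * ((a ⊗ₖ a) ⊗ₖ a) = ((a ⊗ₖ a) ⊗ₖ a) * kron12 N := by
    rw [kron12_mul_kronecker, kronecker_mul_kron12, h]
  have h23 : kron23 M * ((a ⊗ₖ a) ⊗ₖ a) = ((a ⊗ₖ a) ⊗ₖ a) * kron23 N := by
    rw [kron23_mul_kronecker, kronecker_mul_kron23, h]
  generalize (a ⊗ₖ a) ⊗ₖ a = a3 at *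
  generalize (b ⊗ₖ b) ⊗ₖ b = b3 at *
  have e1 : a3 * (kron12 N * kron23 N * kron12 N)
      = kron12 M * kron23 M * kron12 M * a3 := by
    rw [mul_assoc _ _ a3, h12, ← mul_assoc _ a3, mul_assoc _ _ a3, h23, ← mul_assoc _ a3, h12]
    simp only [mul_assoc]
  have e2 : a3 * (kron23 N * kron12 N * kron23 N)
      = kron23 M * kron12 M * kron23 M * a3 := by
    rw [mul_assoc _ _ a3, h23, ← mul_assoc _ a3, mul_assoc _ _ a3, h12, ← mul_assoc _ a3, h23]
    simp only [mul_assoc]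
  have e : a3 * (kron12 N * kron23 N * kron12 N) = a3 * (kron23 N * kron12 N * kron23 N) := by
    rw [e1, e2, show _ = _ from hM]
  have := congrArg (b3 * ·) e
  simp only [← mul_assoc b3, h3, one_mul] at this
  exact this

/-- The equation satisfied by a first-order deformation `D + t • E` of a Yang–Baxter matrix. -/
lemma MatYBE.exists_linearization {D E : Matrix (Q × Q) (Q × Q) A} {t : A}
    (ht : IsLeftRegular t) (hD : MatYBE D) (h : MatYBE (D + t • E)) :
    ∃ W : Matrix ((Q × Q) × Q) ((Q × Q) × Q) A,
      (kron12 E * kron23 D * kron12 D + kron12 D * kron23 E * kron12 D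
        + kron12 D * kron23 D * kron12 E)
      - (kron23 E * kron12 D * kron23 D + kron23 D * kron12 E * kron23 D
        + kron23 D * kron12 D * kron23 E) = t • W := by
  unfold MatYBE at h hD
  simp only [map_add, map_smul] at h
  generalize kron12 D = D1 at *
  generalize kron23 D = D2 at *
  generalize kron12 E = E1 at *
  generalize kron23 E = E2 at *
  refine ⟨-(E1 * E2 * D1 + E1 * D2 * E1 + D1 * E2 * E1 + t • (E1 * E2 * E1))
    + (E2 * E1 * D2 + E2 * D1 * E2 + D2 * E1 * E2 + t • (E2 * E1 * E2)), ?_⟩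
  have key : ∀ X Y : Matrix ((Q × Q) × Q) ((Q × Q) × Q) A, t • X = t • Y → X = Y := by
    intro X Y hXY
    ext i j
    exact ht (congrFun (congrFun hXY i) j)
  apply key
  simp only [add_mul, mul_add, smul_mul_assoc, mul_smul_comm, smul_add, smul_sub, smul_neg] at h ⊢
  rw [← sub_eq_zero] at h hD ⊢
  rw [← sub_eq_zero.2 (h.trans hD.symm)]
  module

variable (Q A) in
/-- The standard basis of `AQ ⊗ AQ`. -/
def basis2 : Module.Basis (Q × Q) A ((Q →₀ A) ⊗[A] (Q →₀ A)) :=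
  Finsupp.basisSingleOne.tensorProduct Finsupp.basisSingleOne

omit [Fintype Q] [DecidableEq Q] in
lemma basis2_apply (p : Q × Q) : basis2 Q A p
    = Finsupp.single p.1 (1 : A) ⊗ₜ[A] Finsupp.single p.2 (1 : A) := by
  simp [basis2, Module.Basis.tensorProduct_apply']

lemma mat2_eq_toMatrix (f : ((Q →₀ A) ⊗[A] (Q →₀ A)) →ₗ[A] ((Q →₀ A) ⊗[A] (Q →₀ A)))
    (p q : Q × Q) : mat2 A f p q = LinearMap.toMatrix (basis2 Q A) (basis2 Q A) f q p := by
  have h : ∀ w : (Q →₀ A) ⊗[A] (Q →₀ A),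
      finsuppTensorFinsupp' A Q Q w q = (basis2 Q A).repr w q := by
    intro w
    induction w using TensorProduct.induction_on with
    | zero => simp
    | tmul a b =>
      obtain ⟨u, v⟩ := q
      simp [basis2, mul_comm]
    | add a b ha hb => simp [ha, hb]
  rw [mat2, LinearMap.toMatrix_apply, basis2_apply, h]
  congr 3
  rw [LinearEquiv.symm_apply_eq]
  simp

variable (Q A) in
/-- The standard basis of `(AQ ⊗ AQ) ⊗ AQ`. -/
def basis3 : Module.Basis ((Q × Q) × Q) A (((Q →₀ A) ⊗[A] (Q →₀ A)) ⊗[A] (Q →₀ A)) :=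
  (basis2 Q A).tensorProduct Finsupp.basisSingleOne

lemma toMatrix_rTensor (c : ((Q →₀ A) ⊗[A] (Q →₀ A)) →ₗ[A] ((Q →₀ A) ⊗[A] (Q →₀ A))) :
    LinearMap.toMatrix (basis3 Q A) (basis3 Q A) (LinearMap.rTensor (Q →₀ A) c)
      = kron12 (LinearMap.toMatrix (basis2 Q A) (basis2 Q A) c) := by
  have hb : ∀ p z, basis3 Q A (p, z) = basis2 Q A p ⊗ₜ Finsupp.single z (1 : A) := by
    intro p z
    simp [basis3, Module.Basis.tensorProduct_apply]
  have hr : ∀ (w : (Q →₀ A) ⊗[A] (Q →₀ A)) (s : Q →₀ A) p z,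
      (basis3 Q A).repr (w ⊗ₜ s) (p, z) = (basis2 Q A).repr w p * s z := by
    intro w s p z
    simp [basis3, mul_comm]
  ext ⟨⟨u, v⟩, w⟩ ⟨⟨x, y⟩, z⟩
  rw [kron12_apply, LinearMap.toMatrix_apply, hb, LinearMap.rTensor_tmul, hr,
    LinearMap.toMatrix_apply]
  simp [Finsupp.single_apply]

lemma toMatrix_lTensor (c : ((Q →₀ A) ⊗[A] (Q →₀ A)) →ₗ[A] ((Q →₀ A) ⊗[A] (Q →₀ A))) :
    LinearMap.toMatrix (basis3 Q A) (basis3 Q A)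
      ((TensorProduct.assoc A (Q →₀ A) (Q →₀ A) (Q →₀ A)).symm.toLinearMap ∘ₗ
        (LinearMap.lTensor (Q →₀ A) c) ∘ₗ
        (TensorProduct.assoc A (Q →₀ A) (Q →₀ A) (Q →₀ A)).toLinearMap)
      = kron23 (LinearMap.toMatrix (basis2 Q A) (basis2 Q A) c) := by
  have hb : ∀ x y z, basis3 Q A ((x, y), z)
      = (TensorProduct.assoc A (Q →₀ A) (Q →₀ A) (Q →₀ A)).symm
        (Finsupp.single x (1 : A) ⊗ₜ basis2 Q A (y, z)) := by
    intro x y z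
    simp [basis3, Module.Basis.tensorProduct_apply, basis2_apply]
  have hr : ∀ (s : Q →₀ A) (w : (Q →₀ A) ⊗[A] (Q →₀ A)) (x y z : Q),
      (basis3 Q A).repr ((TensorProduct.assoc A (Q →₀ A) (Q →₀ A) (Q →₀ A)).symm (s ⊗ₜ w))
          ((x, y), z) = s x * (basis2 Q A).repr w (y, z) := by
    intro s w x y z
    induction w using TensorProduct.induction_on with
    | zero => simp
    | tmul a b => simp [basis3, basis2]; ring
    | add a b ha hb =>
      simp only [TensorProduct.tmul_add, map_add, Finsupp.add_apply, ha, hb, mul_add]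
  ext ⟨⟨u, v⟩, w⟩ ⟨⟨x, y⟩, z⟩
  rw [kron23_apply, LinearMap.toMatrix_apply, hb, LinearMap.comp_apply, LinearMap.comp_apply,
    LinearEquiv.coe_coe, LinearEquiv.coe_coe, LinearEquiv.apply_symm_apply,
    LinearMap.lTensor_tmul, hr, LinearMap.toMatrix_apply]
  simp [Finsupp.single_apply]

lemma YBE_iff_matYBE (c : ((Q →₀ A) ⊗[A] (Q →₀ A)) →ₗ[A] ((Q →₀ A) ⊗[A] (Q →₀ A))) :
    YBE c ↔ MatYBE (LinearMap.toMatrix (basis2 Q A) (basis2 Q A) c) := by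
  rw [YBE, MatYBE, ← (LinearMap.toMatrix (basis3 Q A) (basis3 Q A)).injective.eq_iff,
    LinearMap.toMatrix_comp (basis3 Q A) (basis3 Q A) (basis3 Q A),
    LinearMap.toMatrix_comp (basis3 Q A) (basis3 Q A) (basis3 Q A),
    toMatrix_rTensor, toMatrix_lTensor,
    LinearMap.toMatrix_comp (basis3 Q A) (basis3 Q A) (basis3 Q A),
    LinearMap.toMatrix_comp (basis3 Q A) (basis3 Q A) (basis3 Q A),
    toMatrix_rTensor, toMatrix_lTensor, mul_assoc, mul_assoc]

end MatrixForm

section PermutationMatrix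

variable {ι A : Type*} [Fintype ι] [DecidableEq ι] [CommRing A]

variable (A) in
/-- The matrix of the permutation of the standard basis induced by `s`. -/
def permMat (s : Equiv.Perm ι) : Matrix ι ι A :=
  Matrix.of fun q p => if q = s p then 1 else 0

lemma mul_permMat (M : Matrix ι ι A) (s : Equiv.Perm ι) (q p : ι) :
    (M * permMat A s) q p = M q (s p) := by
  simp [Matrix.mul_apply, permMat]

lemma permMat_mul (M : Matrix ι ι A) (s : Equiv.Perm ι) (q p : ι) :
    (permMat A s * M) (s q) p = M q p := by
  simp [Matrix.mul_apply, permMat]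

lemma isUnit_permMat (s : Equiv.Perm ι) : IsUnit (permMat A s) := by
  refine IsUnit.of_mul_eq_one (permMat A s⁻¹) ?_
  ext q p
  rw [mul_permMat]
  simp [permMat, Matrix.one_apply]

end PermutationMatrix

namespace YBRack

section Braiding

variable {Q A : Type*} (R : YBRack Q)

/-- The braiding `(x, y) ↦ (y, x ^ y)` of a rack. -/
def braid : Equiv.Perm (Q × Q) where
  toFun p := (p.2, R.act p.1 p.2)
  invFun p := ((R.rho p.1).symm p.2, p.1)
  left_inv p := Prod.ext ((R.rho p.2).symm_apply_apply p.1) rfl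
  right_inv p := Prod.ext rfl ((R.rho p.1).apply_symm_apply p.2)

lemma braid_apply (x y : Q) : R.braid (x, y) = (y, R.act x y) := rfl

/-- The braiding of the first two factors. -/
def braid12 : Equiv.Perm ((Q × Q) × Q) := Equiv.prodCongr R.braid (Equiv.refl Q)

/-- The braiding of the last two factors. -/
def braid23 : Equiv.Perm ((Q × Q) × Q) :=
  (Equiv.prodAssoc Q Q Q).trans
    ((Equiv.prodCongr (Equiv.refl Q) R.braid).trans (Equiv.prodAssoc Q Q Q).symm)

lemma braid12_apply (x y z : Q) : R.braid12 ((x, y), z) = ((y, R.act x y), z) := rfl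

lemma braid23_apply (x y z : Q) : R.braid23 ((x, y), z) = ((x, z), R.act y z) := rfl

variable [Fintype Q] [DecidableEq Q] [CommRing A]

lemma kron12_permMat_braid : kron12 (permMat A R.braid) = permMat A R.braid12 := by
  ext ⟨⟨u, v⟩, w⟩ ⟨⟨x, y⟩, z⟩
  by_cases h : z = w
  · simp [kron12_apply, permMat, braid12_apply, braid_apply, h]
  · simp [kron12_apply, permMat, braid12_apply, h, Ne.symm h]

lemma kron23_permMat_braid : kron23 (permMat A R.braid) = permMat A R.braid23 := by
  ext ⟨⟨u, v⟩, w⟩ ⟨⟨x, y⟩, z⟩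
  by_cases h : x = u
  · simp [kron23_apply, permMat, braid23_apply, braid_apply, h]
  · simp [kron23_apply, permMat, braid23_apply, h, Ne.symm h]

lemma isCocycle_of_linearization {E : Matrix (Q × Q) (Q × Q) A}
    (h : (kron12 E * kron23 (permMat A R.braid) * kron12 (permMat A R.braid)
        + kron12 (permMat A R.braid) * kron23 E * kron12 (permMat A R.braid)
        + kron12 (permMat A R.braid) * kron23 (permMat A R.braid) * kron12 E)
      - (kron23 E * kron12 (permMat A R.braid) * kron23 (permMat A R.braid)
        + kron23 (permMat A R.braid) * kron12 E * kron23 (permMat A R.braid)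
        + kron23 (permMat A R.braid) * kron12 (permMat A R.braid) * kron23 E) = 0) :
    R.IsCocycle fun x y u v => E (R.braid (u, v)) (x, y) := by
  intro x y z u v w
  rw [kron12_permMat_braid, kron23_permMat_braid] at h
  have hr : R.braid12 (R.braid23 (R.braid12 ((u, v), w)))
      = R.braid23 (R.braid12 (R.braid23 ((u, v), w))) := by
    simp only [braid12_apply, braid23_apply, R.self_distrib u v w]
  have h1 : ∀ M : Matrix ((Q × Q) × Q) ((Q × Q) × Q) A,
      (permMat A R.braid23 * M) (R.braid12 (R.braid23 (R.braid12 ((u, v), w)))) ((x, y), z)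
        = M (R.braid12 (R.braid23 ((u, v), w))) ((x, y), z) := by
    intro M
    rw [hr, permMat_mul]
  have h' := congrFun (congrFun h (R.braid12 (R.braid23 (R.braid12 ((u, v), w))))) ((x, y), z)
  simp only [Matrix.sub_apply, Matrix.add_apply, Matrix.zero_apply] at h'
  rw [mul_assoc (permMat A R.braid12) (kron23 E), mul_assoc (permMat A R.braid12) (permMat A _),
    mul_assoc (permMat A R.braid23) (kron12 E), mul_assoc (permMat A R.braid23) (permMat A _),
    h1, h1] at h'
  simp only [permMat_mul, mul_permMat] at h'
  simp only [braid12_apply, braid23_apply, kron12_apply, kron23_apply] at h'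
  simp only [braid_apply, R.self_distrib u v w] at h' ⊢
  simp only [← R.self_distrib u v w] at h' ⊢
  linear_combination h'

end Braiding

end YBRack

/-- An action of a set `Z` of central symmetries on a rack whose orbits are the classes of
behavioural equivalence, together with an indexing `cls` of the orbits of inner
automorphisms. -/
structure CentralAction {Q : Type*} (R : YBRack Q) (Z I : Type*) [One Z] where
  zm : Z → Q → Q
  cls : Q → I
  one_zm : ∀ x, zm 1 x = x
  zm_comm : ∀ a b x, zm a (zm b x) = zm b (zm a x)
  act_zm_left : ∀ z x y, R.act (zm z x) y = zm z (R.act x y)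
  act_zm_right : ∀ z x y, R.act x (zm z y) = R.act x y
  cls_zm : ∀ z x, cls (zm z x) = cls x
  cls_act : ∀ x y, cls (R.act x y) = cls x
  zm_inj : ∀ a b x, zm a x = zm b x → a = b
  exists_zm : ∀ x u, R.BEquiv x u → ∃ z, u = zm z x
  cls_surjective : Function.Surjective cls
  exists_mem_Inn : ∀ x x', cls x = cls x' → ∃ g ∈ R.Inn, g x = x'

namespace CentralAction

section Formula

variable {Q : Type*} {R : YBRack Q} {Z I : Type*} [One Z] [Fintype Z] (S : CentralAction R Z I)
variable {A : Type*} [CommRing A]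

/-- The central form with coefficients `lam` of an endomorphism of `AQ ⊗ AQ`. -/
def HasForm (lam : I → I → Z × Z → A)
    (c : ((Q →₀ A) ⊗[A] (Q →₀ A)) →ₗ[A] ((Q →₀ A) ⊗[A] (Q →₀ A))) : Prop :=
  ∀ x y, c (Finsupp.single x (1 : A) ⊗ₜ[A] Finsupp.single y (1 : A))
    = ∑ z : Z × Z, lam (S.cls x) (S.cls y) z •
      (Finsupp.single (S.zm z.1 y) (1 : A) ⊗ₜ[A]
        Finsupp.single (S.zm z.2 (R.act x y)) (1 : A))

variable {S} in
theorem HasForm.YBE {lam : I → I → Z × Z → A}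
    {c : ((Q →₀ A) ⊗[A] (Q →₀ A)) →ₗ[A] ((Q →₀ A) ⊗[A] (Q →₀ A))} (hc : S.HasForm lam c) :
    YBE c := by
  let V := Q →₀ A
  let tri : Q → Q → Q → (V ⊗[A] V) ⊗[A] V := fun x y z =>
    (Finsupp.single x (1 : A) ⊗ₜ[A] Finsupp.single y (1 : A)) ⊗ₜ[A] Finsupp.single z (1 : A)
  unfold _root_.YBE
  have h12 : ∀ x y z, LinearMap.rTensor V c (tri x y z)
      = ∑ s : Z × Z, lam (S.cls x) (S.cls y) s • tri (S.zm s.1 y) (S.zm s.2 (R.act x y)) z := by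
    intro x y z
    simp only [tri, LinearMap.rTensor_tmul, hc x y, TensorProduct.sum_tmul,
      TensorProduct.smul_tmul']
  have h23 : ∀ x y z, ((TensorProduct.assoc A V V V).symm.toLinearMap ∘ₗ
        (LinearMap.lTensor V c) ∘ₗ (TensorProduct.assoc A V V V).toLinearMap) (tri x y z)
      = ∑ s : Z × Z, lam (S.cls y) (S.cls z) s • tri x (S.zm s.1 z) (S.zm s.2 (R.act y z)) := by
    intro x y z
    simp only [tri, LinearMap.comp_apply, LinearEquiv.coe_coe, TensorProduct.assoc_tmul,
      LinearMap.lTensor_tmul, hc y z, TensorProduct.tmul_sum, TensorProduct.tmul_smul, map_sum,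
      map_smul, TensorProduct.assoc_symm_tmul]
  change LinearMap.rTensor V c ∘ₗ ((TensorProduct.assoc A V V V).symm.toLinearMap ∘ₗ
        (LinearMap.lTensor V c) ∘ₗ (TensorProduct.assoc A V V V).toLinearMap) ∘ₗ
        LinearMap.rTensor V c
      = ((TensorProduct.assoc A V V V).symm.toLinearMap ∘ₗ
        (LinearMap.lTensor V c) ∘ₗ (TensorProduct.assoc A V V V).toLinearMap) ∘ₗ
        LinearMap.rTensor V c ∘ₗ ((TensorProduct.assoc A V V V).symm.toLinearMap ∘ₗ
        (LinearMap.lTensor V c) ∘ₗ (TensorProduct.assoc A V V V).toLinearMap)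
  generalize LinearMap.rTensor V c = c1 at *
  generalize (TensorProduct.assoc A V V V).symm.toLinearMap ∘ₗ
        (LinearMap.lTensor V c) ∘ₗ (TensorProduct.assoc A V V V).toLinearMap = c2 at *
  let b : Module.Basis Q A V := Finsupp.basisSingleOne
  refine ((b.tensorProduct b).tensorProduct b).ext ?_
  rintro ⟨⟨x, y⟩, z⟩
  have hb : ((b.tensorProduct b).tensorProduct b) ((x, y), z) = tri x y z := by
    have hbx : ∀ x, b x = Finsupp.single x (1 : A) :=
      fun x => congrFun Finsupp.coe_basisSingleOne x
    rw [Module.Basis.tensorProduct_apply, Module.Basis.tensorProduct_apply, hbx, hbx, hbx]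
  rw [hb]
  simp only [LinearMap.comp_apply, h12, h23, map_sum, map_smul, Finset.smul_sum, smul_smul,
    S.cls_zm, S.cls_act, S.act_zm_left, S.act_zm_right]
  simp only [R.self_distrib x y z]
  rw [Finset.sum_comm]
  refine (Finset.sum_congr rfl fun b _ => Finset.sum_comm).trans ?_
  rw [Finset.sum_comm]
  refine Finset.sum_congr rfl fun d _ => Finset.sum_congr rfl fun b _ =>
    Finset.sum_congr rfl fun a _ => ?_
  rw [S.zm_comm d.1 b.1, S.zm_comm d.2 a.1, S.zm_comm b.2 a.2]
  congr 1
  ring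

end Formula

section Matrix

variable {Q : Type*} {R : YBRack Q} {Z I : Type*} [One Z] [Fintype Z] (S : CentralAction R Z I)
variable {A : Type*} [CommRing A] [Fintype Q] [DecidableEq Q]

/-- The matrix of the endomorphism of central form with coefficients `lam`. -/
def centralMatrix (lam : I → I → Z × Z → A) : Matrix (Q × Q) (Q × Q) A :=
  Matrix.of fun q p => ∑ z : Z × Z, lam (S.cls p.1) (S.cls p.2) z *
    if q = (S.zm z.1 p.2, S.zm z.2 (R.act p.1 p.2)) then 1 else 0

omit [Fintype Q] in
lemma centralMatrix_add_smul (lam mu : I → I → Z × Z → A) (t : A) :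
    S.centralMatrix (fun i j z => lam i j z + t * mu i j z)
      = S.centralMatrix lam + t • S.centralMatrix mu := by
  ext q p
  simp only [centralMatrix, add_mul, Finset.sum_add_distrib, Finset.mul_sum, mul_assoc,
    Matrix.of_apply, Matrix.add_apply, Matrix.smul_apply, smul_eq_mul]

omit [Fintype Q] in
lemma centralMatrix_map {B : Type*} [CommRing B] (π : A →+* B) (lam : I → I → Z × Z → A) :
    (S.centralMatrix lam).map π = S.centralMatrix fun i j z => π (lam i j z) := by
  ext q p
  simp [centralMatrix, apply_ite]

omit [Fintype Q] in
open scoped Classical in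
lemma centralMatrix_one :
    S.centralMatrix (fun _ _ z => if z = 1 then (1 : A) else 0) = permMat A R.braid := by
  ext q p
  simp only [centralMatrix, permMat, Matrix.of_apply]
  rw [Finset.sum_eq_single 1]
  · simp [S.one_zm, YBRack.braid]
    congr
  · intro z _ hz
    simp [hz]
  · simp

lemma hasForm_iff (lam : I → I → Z × Z → A)
    (c : ((Q →₀ A) ⊗[A] (Q →₀ A)) →ₗ[A] ((Q →₀ A) ⊗[A] (Q →₀ A))) :
    S.HasForm lam c ↔
      LinearMap.toMatrix (basis2 Q A) (basis2 Q A) c = S.centralMatrix lam := by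
  have h : ∀ x y, c (Finsupp.single x (1 : A) ⊗ₜ[A] Finsupp.single y (1 : A))
        = ∑ z : Z × Z, lam (S.cls x) (S.cls y) z •
          (Finsupp.single (S.zm z.1 y) (1 : A) ⊗ₜ[A]
            Finsupp.single (S.zm z.2 (R.act x y)) (1 : A))
      ↔ ∀ q, LinearMap.toMatrix (basis2 Q A) (basis2 Q A) c q (x, y)
        = S.centralMatrix lam q (x, y) := by
    intro x y
    have e : ∀ x y, (Finsupp.single x (1 : A) ⊗ₜ[A] Finsupp.single y (1 : A))
      = basis2 Q A (x, y) := fun x y => (basis2_apply (x, y)).symm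
    simp only [e]
    rw [← (basis2 Q A).repr.injective.eq_iff, DFunLike.ext_iff]
    refine forall_congr' fun q => ?_
    simp [LinearMap.toMatrix_apply, centralMatrix, Finsupp.single_apply, eq_comm]
  rw [HasForm, ← Matrix.ext_iff]
  simp only [h]
  constructor
  · rintro h q ⟨x, y⟩
    exact h x y q
  · intro h x y q
    exact h q (x, y)

lemma matYBE_centralMatrix (lam : I → I → Z × Z → A) : MatYBE (S.centralMatrix lam) := by
  let c := (LinearMap.toMatrix (basis2 Q A) (basis2 Q A)).symm (S.centralMatrix lam)
  have h : LinearMap.toMatrix (basis2 Q A) (basis2 Q A) c = S.centralMatrix lam :=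
    LinearEquiv.apply_symm_apply _ _
  rw [← h, ← YBE_iff_matYBE]
  exact ((S.hasForm_iff lam c).2 h).YBE

omit [Fintype Z] [Fintype Q] [DecidableEq Q] in
lemma Inn_zm {g : Equiv.Perm Q} (hg : g ∈ R.Inn) (z : Z) : ∀ x, g (S.zm z x) = S.zm z (g x) := by
  refine R.Inn_induction (p := fun g => ∀ x, g (S.zm z x) = S.zm z (g x)) ?_ ?_ ?_ ?_ hg
  · intro x; rfl
  · intro y x; exact S.act_zm_left z x y
  · intro g k _ _ h1 h2 x; simp [h1, h2]
  · intro g _ h x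
    apply g.injective
    simp [h]

omit [Fintype Q] in
/-- Entropic kernels are those of central form. -/
lemma exists_centralMatrix {F : Q → Q → Q → Q → A} (hF : R.IsEntropic F) :
    ∃ lam : I → I → Z × Z → A, ∀ x y u v,
      S.centralMatrix lam (R.braid (u, v)) (x, y) = F x y u v := by
  classical
  let r := Function.surjInv S.cls_surjective
  have hr : ∀ i, S.cls (r i) = i := Function.surjInv_eq S.cls_surjective
  have hzm : ∀ z x, R.BEquiv x (S.zm z x) := by
    intro z x
    rw [R.bEquiv_iff]
    intro a
    rw [S.act_zm_right]
  refine ⟨fun i j z => F (r i) (r j) (S.zm z.2 (r i)) (S.zm z.1 (r j)), fun x y u v => ?_⟩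
  obtain ⟨g, hg, hgx⟩ := S.exists_mem_Inn (r (S.cls x)) x (hr _)
  obtain ⟨k, hk, hky⟩ := S.exists_mem_Inn (r (S.cls y)) y (hr _)
  have hval : ∀ z : Z × Z, F (r (S.cls x)) (r (S.cls y)) (S.zm z.2 (r (S.cls x)))
      (S.zm z.1 (r (S.cls y))) = F x y (S.zm z.2 x) (S.zm z.1 y) := by
    intro z
    rw [← hF.equivariant g hg k hk, S.Inn_zm hg, S.Inn_zm hk, hgx, hky]
  have hcond : ∀ z : Z × Z, R.braid (u, v) = (S.zm z.1 y, S.zm z.2 (R.act x y))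
      ↔ v = S.zm z.1 y ∧ u = S.zm z.2 x := by
    intro z
    rw [R.braid_apply, Prod.mk.injEq]
    refine and_congr_right fun hv => ?_
    rw [hv, S.act_zm_right, ← S.act_zm_left, R.act_left_inj]
  simp only [centralMatrix, Matrix.of_apply, hval, hcond]
  by_cases h : R.BEquiv x u ∧ R.BEquiv y v
  · obtain ⟨a, rfl⟩ := S.exists_zm x u h.1
    obtain ⟨b, rfl⟩ := S.exists_zm y v h.2
    rw [Finset.sum_eq_single (b, a)]
    · simp
    · rintro ⟨b', a'⟩ _ hne
      rw [if_neg, mul_zero]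
      rintro ⟨h1, h2⟩
      exact hne (Prod.ext (S.zm_inj _ _ _ h1).symm (S.zm_inj _ _ _ h2).symm)
    · simp
  · rw [hF.quasi_diagonal x y u v (by tauto)]
    refine Finset.sum_eq_zero fun z _ => ?_
    rw [if_neg, mul_zero]
    rintro ⟨rfl, rfl⟩
    exact h ⟨hzm _ _, hzm _ _⟩

end Matrix

end CentralAction

section PowerSeriesLimit

open PowerSeries

variable {K : Type*} [CommRing K]

/-- Completeness of the ring of power series: successive approximations converge. -/
lemma exists_powerSeries_limit {ι : Type*} (P : ℕ → (ι → K⟦X⟧) → Prop)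
    (h0 : ∃ s, P 0 s)
    (step : ∀ k s, P k s → ∃ s', P (k + 1) s' ∧ ∀ i, (X : K⟦X⟧) ^ (k + 1) ∣ s' i - s i) :
    ∃ s : ι → K⟦X⟧, ∀ k, ∃ s', P k s' ∧ ∀ i, (X : K⟦X⟧) ^ (k + 1) ∣ s i - s' i := by
  choose s0 hs0 using h0
  choose! next hnext hdvd using step
  let f : ℕ → ι → K⟦X⟧ := fun k => Nat.rec s0 next k
  have hf : ∀ k, P k (f k) := by
    intro k
    induction k with
    | zero => exact hs0
    | succ k ih => exact hnext k _ ih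
  have hle : ∀ k m i, (X : K⟦X⟧) ^ (k + 1) ∣ f (k + m) i - f k i := by
    intro k m i
    induction m with
    | zero => simp
    | succ m ih =>
      have h1 : (X : K⟦X⟧) ^ (k + 1) ∣ f (k + m + 1) i - f (k + m) i :=
        (pow_dvd_pow X (by lia)).trans (hdvd (k + m) _ (hf _) i)
      have := dvd_add h1 ih
      rwa [sub_add_sub_cancel] at this
  refine ⟨fun i => mk fun m => coeff m (f m i), fun k => ⟨f k, hf k, fun i => ?_⟩⟩
  rw [X_pow_dvd_iff]
  intro m hm
  obtain ⟨d, rfl⟩ := Nat.exists_eq_add_of_le (Nat.le_of_lt_succ hm)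
  have := X_pow_dvd_iff.1 (hle m d i) m (Nat.lt_succ_self m)
  rw [map_sub, sub_eq_zero] at this
  rw [map_sub, coeff_mk, this, sub_self]

lemma exists_eq_X_smul_of_map_constantCoeff {m n : Type*} {M : Matrix m n K⟦X⟧}
    (h : M.map (constantCoeff (R := K)) = 0) : ∃ N, M = (X : K⟦X⟧) • N := by
  have hd : ∀ i j, ∃ c, M i j = X * c := fun i j =>
    X_dvd_iff.2 (congrFun (congrFun h i) j)
  choose N hN using hd
  exact ⟨Matrix.of N, by ext1 i j; exact hN i j⟩

lemma isUnit_matrix_iff_map_constantCoeff {n : Type*} [Fintype n] [DecidableEq n]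
    (M : Matrix n n K⟦X⟧) : IsUnit M ↔ IsUnit (M.map (constantCoeff (R := K))) := by
  rw [Matrix.isUnit_iff_isUnit_det, Matrix.isUnit_iff_isUnit_det, isUnit_iff_constantCoeff,
    RingHom.map_det]
  rfl

end PowerSeriesLimit

lemma conj_one_add_smul_expansion {A M : Type*} [CommRing A] [Ring M] [Algebra A M] (t : A)
    (L e B D N : M) :
    (L + t • e) * (1 + t • B + (t * t) • D) - (1 + t • B + (t * t) • D) * (L + t • N)
      = t • (e + L * B - B * L - N) + (t * t) • (e * B + L * D - D * L - B * N)
        + (t * (t * t)) • (e * D - D * N) := by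
  simp only [add_mul, mul_add, smul_mul_assoc, mul_smul_comm, smul_add, smul_sub, smul_smul,
    mul_one, one_mul]
  module

namespace CentralAction

section Gauge

open PowerSeries
open scoped Kronecker

variable {Q : Type*} {R : YBRack Q} {Z I : Type*} [One Z] [Fintype Z] (S : CentralAction R Z I)
variable [Fintype Q] [DecidableEq Q]

/-- The failure of `a ⊗ a` to conjugate `T` into the central form with coefficients `lam`. -/
def gaugeDefect {A : Type*} [CommRing A] (T : Matrix (Q × Q) (Q × Q) A) (a : Matrix Q Q A)
    (lam : I → I → Z × Z → A) : Matrix (Q × Q) (Q × Q) A :=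
  T * (a ⊗ₖ a) - (a ⊗ₖ a) * S.centralMatrix lam

lemma gaugeDefect_map {A B : Type*} [CommRing A] [CommRing B] (π : A →+* B)
    (T : Matrix (Q × Q) (Q × Q) A) (a : Matrix Q Q A) (lam : I → I → Z × Z → A) :
    (S.gaugeDefect T a lam).map π
      = S.gaugeDefect (T.map π) (a.map π) fun i j z => π (lam i j z) := by
  have hk : (a ⊗ₖ a).map π = a.map π ⊗ₖ a.map π := by
    ext ⟨u, v⟩ ⟨x, y⟩
    simp
  rw [gaugeDefect, gaugeDefect, Matrix.map_sub π (map_sub π), Matrix.map_mul, Matrix.map_mul, hk,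
    S.centralMatrix_map]

/-- Every solution of the linearized Yang–Baxter equation at the braiding of a rack is of central
form up to the infinitesimal action of an endomorphism. -/
lemma exists_central_of_linearization {K : Type*} [Field K] [CharZero K]
    {E : Matrix (Q × Q) (Q × Q) K}
    (h : (kron12 E * kron23 (permMat K R.braid) * kron12 (permMat K R.braid)
        + kron12 (permMat K R.braid) * kron23 E * kron12 (permMat K R.braid)
        + kron12 (permMat K R.braid) * kron23 (permMat K R.braid) * kron12 E)
      - (kron23 E * kron12 (permMat K R.braid) * kron23 (permMat K R.braid)
        + kron23 (permMat K R.braid) * kron12 E * kron23 (permMat K R.braid)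
        + kron23 (permMat K R.braid) * kron12 (permMat K R.braid) * kron23 E) = 0) :
    ∃ (b : Matrix Q Q K) (mu : I → I → Z × Z → K),
      E + permMat K R.braid * (b ⊗ₖ 1 + 1 ⊗ₖ b) - (b ⊗ₖ 1 + 1 ⊗ₖ b) * permMat K R.braid
        - S.centralMatrix mu = 0 := by
  obtain ⟨β, hβ⟩ := (R.isCocycle_of_linearization h).exists_isEntropic
  obtain ⟨mu, hmu⟩ := S.exists_centralMatrix hβ
  refine ⟨Matrix.of fun u x => β x u, mu, ?_⟩
  ext q ⟨x, y⟩
  obtain ⟨⟨u, v⟩, rfl⟩ := R.braid.surjective q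
  simp only [Matrix.sub_apply, Matrix.add_apply, hmu, permMat_mul, mul_permMat, YBRack.coboundary]
  simp only [YBRack.braid_apply, Matrix.kroneckerMap_apply, Matrix.one_apply, Matrix.of_apply,
    Matrix.zero_apply, eq_comm (a := u), eq_comm (a := v), eq_comm (a := R.act u v)]
  ring

/-- An approximate reduction to central form improves by one order. -/
lemma exists_gaugeDefect_succ {K : Type*} [Field K] [CharZero K]
    {T : Matrix (Q × Q) (Q × Q) K⟦X⟧} (hT : MatYBE T)
    {a : Matrix Q Q K⟦X⟧} {lam : I → I → Z × Z → K⟦X⟧}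
    (ha : a.map (constantCoeff (R := K)) = 1)
    (hlam : (S.centralMatrix lam).map (constantCoeff (R := K)) = permMat K R.braid)
    {k : ℕ} {e₀ : Matrix (Q × Q) (Q × Q) K⟦X⟧}
    (he : S.gaugeDefect T a lam = (X : K⟦X⟧) ^ (k + 1) • e₀) :
    ∃ (b : Matrix Q Q K⟦X⟧) (mu : I → I → Z × Z → K⟦X⟧) (e₁ : Matrix (Q × Q) (Q × Q) K⟦X⟧),
      S.gaugeDefect T (a + (X : K⟦X⟧) ^ (k + 1) • b)
        (fun i j z => lam i j z + (X : K⟦X⟧) ^ (k + 1) * mu i j z)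
          = (X : K⟦X⟧) ^ (k + 2) • e₁ := by
  have hau : IsUnit a := by
    rw [isUnit_matrix_iff_map_constantCoeff, ha]
    exact isUnit_one
  obtain ⟨a', haa'⟩ := hau.exists_right_inv
  have haa2 : (a ⊗ₖ a) * (a' ⊗ₖ a') = 1 := by
    rw [← Matrix.mul_kronecker_mul, haa', Matrix.one_kronecker_one]
  set t : K⟦X⟧ := X ^ (k + 1) with ht
  set L := S.centralMatrix lam with hL
  let e := (a' ⊗ₖ a') * e₀
  have hTa : T * (a ⊗ₖ a) = (a ⊗ₖ a) * (L + t • e) := by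
    rw [gaugeDefect, sub_eq_iff_eq_add] at he
    rw [he, mul_add, Matrix.mul_smul, ← mul_assoc, haa2, one_mul, add_comm]
  clear_value e
  have hreg : IsLeftRegular t := (IsRegular.of_ne_zero (pow_ne_zero _ X_ne_zero)).left
  obtain ⟨W, hW⟩ := (S.matYBE_centralMatrix lam).exists_linearization hreg (hT.conj hau hTa)
  have hW' := congrArg (fun M => Matrix.map M (constantCoeff (R := K))) hW
  have hsm : ∀ {m : Type _} (M : Matrix m m K⟦X⟧), (t • M).map (constantCoeff (R := K)) = 0 := by
    intro m M
    ext i j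
    simp [ht]
  simp only [Matrix.map_sub _ (map_sub (constantCoeff (R := K))),
    Matrix.map_add _ (map_add (constantCoeff (R := K))), Matrix.map_mul, ← kron12_map,
    ← kron23_map] at hW'
  rw [hsm, ← hL, hlam] at hW'
  obtain ⟨b, mu, hbm⟩ := S.exists_central_of_linearization hW'
  let b' : Matrix Q Q K⟦X⟧ := b.map (C (R := K))
  let mu' : I → I → Z × Z → K⟦X⟧ := fun i j z => C (mu i j z)
  let B : Matrix (Q × Q) (Q × Q) K⟦X⟧ := b' ⊗ₖ 1 + 1 ⊗ₖ b'
  let M := S.centralMatrix mu'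
  have hB : B.map (constantCoeff (R := K)) = b ⊗ₖ 1 + 1 ⊗ₖ b := by
    ext ⟨u, v⟩ ⟨x, y⟩
    simp only [B, b', Matrix.map_apply, Matrix.add_apply, Matrix.kroneckerMap_apply,
      Matrix.one_apply, map_add, map_mul, apply_ite (constantCoeff (R := K)), map_one, map_zero,
      constantCoeff_C]
  have hM : M.map (constantCoeff (R := K)) = S.centralMatrix mu := by
    rw [S.centralMatrix_map]
    simp only [mu', constantCoeff_C]
  obtain ⟨Y, hY⟩ : ∃ Y, e + L * B - B * L - M = (X : K⟦X⟧) • Y := by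
    apply exists_eq_X_smul_of_map_constantCoeff
    simp only [Matrix.map_sub _ (map_sub (constantCoeff (R := K))),
      Matrix.map_add _ (map_add (constantCoeff (R := K))), Matrix.map_mul, hB, hM]
    rw [hlam, hbm]
  have hk : (1 + t • b') ⊗ₖ (1 + t • b') = 1 + t • B + (t * t) • (b' ⊗ₖ b') := by
    simp only [Matrix.add_kronecker, Matrix.kronecker_add, Matrix.smul_kronecker,
      Matrix.kronecker_smul, Matrix.one_kronecker_one, B]
    simp only [smul_add, smul_smul]
    abel
  have htt : t * t = X ^ (k + 2) * X ^ k := by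
    rw [ht]; ring
  let e₁ : Matrix (Q × Q) (Q × Q) K⟦X⟧ := (a ⊗ₖ a) * (Y + (X : K⟦X⟧) ^ k • (e * B + L * (b' ⊗ₖ b') - (b' ⊗ₖ b') * L - B * M)
    + (t * X ^ k) • (e * (b' ⊗ₖ b') - (b' ⊗ₖ b') * M))
  refine ⟨a * b', mu', e₁, ?_⟩
  have ha1 : a + t • (a * b') = a * (1 + t • b') := by
    rw [mul_add, mul_one, Matrix.mul_smul]
  rw [gaugeDefect, S.centralMatrix_add_smul, ha1, Matrix.mul_kronecker_mul, ← mul_assoc, hTa,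
    mul_assoc, mul_assoc, ← mul_sub, hk, ← mul_smul_comm (X ^ (k + 2)) (a ⊗ₖ a)]
  congr 1
  have hX : (X : K⟦X⟧) ^ (k + 2) • Y = t • (e + L * B - B * L - M) := by
    rw [hY, smul_smul, ht]
    ring_nf
  change (L + t • e) * (1 + t • B + (t * t) • (b' ⊗ₖ b'))
    - (1 + t • B + (t * t) • (b' ⊗ₖ b')) * (L + t • M) = _
  clear_value B M
  rw [smul_add, smul_add, hX, smul_smul, smul_smul, ← htt,
    show (X : K⟦X⟧) ^ (k + 2) * (t * X ^ k) = t * (t * t) by rw [htt]; ring]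
  exact conj_one_add_smul_expansion t L e B (b' ⊗ₖ b') M

open scoped Classical in
/-- Over power series, every Yang–Baxter matrix congruent to the braiding of the rack is conjugate
to a matrix of central form. -/
theorem exists_gaugeDefect_eq_zero {K : Type*} [Field K] [CharZero K]
    {T : Matrix (Q × Q) (Q × Q) K⟦X⟧} (hT : MatYBE T)
    (hT₀ : T.map (constantCoeff (R := K)) = permMat K R.braid) :
    ∃ (a : Matrix Q Q K⟦X⟧) (lam : I → I → Z × Z → K⟦X⟧),
      a.map (constantCoeff (R := K)) = 1 ∧
      (∀ i j z, constantCoeff (lam i j z) = if z = 1 then 1 else 0) ∧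
      S.gaugeDefect T a lam = 0 := by
  let α : ((Q × Q) ⊕ (I × I × (Z × Z)) → K⟦X⟧) → Matrix Q Q K⟦X⟧ :=
    fun s => Matrix.of fun u x => s (Sum.inl (u, x))
  let Λ : ((Q × Q) ⊕ (I × I × (Z × Z)) → K⟦X⟧) → I → I → Z × Z → K⟦X⟧ :=
    fun s i j z => s (Sum.inr (i, j, z))
  have hL : ∀ lam : I → I → Z × Z → K⟦X⟧,
      (∀ i j z, constantCoeff (lam i j z) = if z = 1 then 1 else 0) →
      (S.centralMatrix lam).map (constantCoeff (R := K)) = permMat K R.braid := by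
    intro lam h
    rw [S.centralMatrix_map, ← S.centralMatrix_one]
    simp only [h]
  let P : ℕ → ((Q × Q) ⊕ (I × I × (Z × Z)) → K⟦X⟧) → Prop := fun k s =>
    (α s).map (constantCoeff (R := K)) = 1 ∧
      (∀ i j z, constantCoeff (Λ s i j z) = if z = 1 then 1 else 0) ∧
      ∃ e, S.gaugeDefect T (α s) (Λ s) = (X : K⟦X⟧) ^ (k + 1) • e
  have hP₀ : ∃ s, P 0 s := by
    refine ⟨Sum.elim (fun p => if p.1 = p.2 then 1 else 0)
      (fun i => if i.2.2 = 1 then 1 else 0), ?_, ?_, ?_⟩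
    · ext u x
      by_cases h : u = x <;> simp [α, h, Matrix.one_apply]
    · intro i j z
      by_cases h : z = 1 <;> simp [Λ, h]
    · simp only [zero_add, pow_one]
      apply exists_eq_X_smul_of_map_constantCoeff
      rw [S.gaugeDefect_map, hT₀]
      have h1 : (α (Sum.elim (fun p => if p.1 = p.2 then 1 else 0)
          (fun i => if i.2.2 = 1 then 1 else 0))).map (constantCoeff (R := K)) = 1 := by
        ext u x
        by_cases h : u = x <;> simp [α, h, Matrix.one_apply]
      have h2 : (fun (i j : I) (z : Z × Z) => constantCoeff
          (Λ (Sum.elim (fun p => if p.1 = p.2 then 1 else 0)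
            (fun i => if i.2.2 = 1 then 1 else 0)) i j z))
          = fun _ _ z => if z = 1 then (1 : K) else 0 := by
        funext i j z
        by_cases h : z = 1 <;> simp [Λ, h]
      rw [h1, h2, gaugeDefect, S.centralMatrix_one, Matrix.one_kronecker_one, mul_one, one_mul,
        sub_self]
  have hstep : ∀ k s, P k s → ∃ s', P (k + 1) s' ∧ ∀ i, (X : K⟦X⟧) ^ (k + 1) ∣ s' i - s i := by
    rintro k s ⟨h1, h2, e, he⟩
    obtain ⟨b, mu, e₁, he₁⟩ := S.exists_gaugeDefect_succ hT h1 (hL _ h2) he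
    refine ⟨Sum.elim (fun p => s (Sum.inl p) + X ^ (k + 1) * b p.1 p.2)
      (fun i => s (Sum.inr i) + X ^ (k + 1) * mu i.1 i.2.1 i.2.2), ⟨?_, ?_, e₁, ?_⟩, ?_⟩
    · rw [← h1]
      ext u x
      simp [α]
    · intro i j z
      rw [← h2 i j z]
      simp [Λ]
    · exact he₁
    · rintro (i | i) <;> simp
  obtain ⟨s, hs⟩ := exists_powerSeries_limit P hP₀ hstep
  obtain ⟨s₀, ⟨h1, h2, -⟩, h3⟩ := hs 0
  have hc : ∀ i, constantCoeff (s i) = constantCoeff (s₀ i) := by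
    intro i
    have := h3 i
    rwa [zero_add, pow_one, X_dvd_iff, map_sub, sub_eq_zero] at this
  refine ⟨α s, Λ s, ?_, ?_, ?_⟩
  · rw [← h1]
    ext u x
    exact hc _
  · intro i j z
    rw [← h2]
    exact hc _
  · ext q p : 1
    refine PowerSeries.ext fun k => ?_
    obtain ⟨s', ⟨-, -, e, he⟩, hd⟩ := hs k
    let φ := Ideal.Quotient.mk (Ideal.span {(X : K⟦X⟧) ^ (k + 1)})
    have hφ : ∀ i, φ (s i) = φ (s' i) := fun i =>
      Ideal.Quotient.eq.2 (Ideal.mem_span_singleton.2 (hd i))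
    have hα : (α s).map φ = (α s').map φ := by
      ext u x
      exact hφ _
    have hΛ : (fun i j z => φ (Λ s i j z)) = fun i j z => φ (Λ s' i j z) := by
      funext i j z
      exact hφ _
    have h0 : (S.gaugeDefect T (α s) (Λ s)).map φ = (S.gaugeDefect T (α s') (Λ s')).map φ := by
      rw [S.gaugeDefect_map, S.gaugeDefect_map, hα, hΛ]
    have h3 := Ideal.mem_span_singleton.1 (Ideal.Quotient.eq.1 (congrFun (congrFun h0 q) p))
    rw [he] at h3
    have h4 : (X : K⟦X⟧) ^ (k + 1) ∣ S.gaugeDefect T (α s) (Λ s) q p :=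
      (dvd_iff_dvd_of_dvd_sub h3).2 ⟨e q p, rfl⟩
    simpa using X_pow_dvd_iff.1 h4 k (Nat.lt_succ_self k)

end Gauge

end CentralAction

namespace CentralAction

section Operators

open PowerSeries
open scoped Kronecker

variable {Q : Type*} {R : YBRack Q} {Z I : Type*} [One Z] [Fintype Z] {S : CentralAction R Z I}
variable [Finite Q] {K : Type*} [Field K]

open scoped Classical in
/-- Operators of central form congruent to the braiding are Yang–Baxter operators. -/
theorem HasForm.isYBOp {lam : I → I → Z × Z → K⟦X⟧}
    {c : ((Q →₀ K⟦X⟧) ⊗[K⟦X⟧] (Q →₀ K⟦X⟧)) →ₗ[K⟦X⟧] ((Q →₀ K⟦X⟧) ⊗[K⟦X⟧] (Q →₀ K⟦X⟧))}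
    (hc : S.HasForm lam c)
    (hlam : ∀ i j z, constantCoeff (lam i j z) = if z = 1 then 1 else 0) : IsYBOp c := by
  have := Fintype.ofFinite Q
  refine ⟨?_, hc.YBE⟩
  rw [← Module.End.isUnit_iff,
    ← MulEquiv.isUnit_map (LinearMap.toMatrixAlgEquiv (basis2 Q K⟦X⟧))]
  change IsUnit (LinearMap.toMatrix (basis2 Q K⟦X⟧) (basis2 Q K⟦X⟧) c)
  rw [(S.hasForm_iff lam c).1 hc, isUnit_matrix_iff_map_constantCoeff, S.centralMatrix_map]
  simp only [hlam]
  rw [S.centralMatrix_one]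
  exact isUnit_permMat _

variable (S) in
open scoped Classical in
/-- Every Yang–Baxter deformation of the braiding is equivalent to one of central form. -/
theorem exists_hasForm_equivalent [CharZero K]
    {c' : ((Q →₀ K⟦X⟧) ⊗[K⟦X⟧] (Q →₀ K⟦X⟧)) →ₗ[K⟦X⟧] ((Q →₀ K⟦X⟧) ⊗[K⟦X⟧] (Q →₀ K⟦X⟧))}
    (hc' : YBE c')
    (hdef : ∀ p q, constantCoeff (mat2 K⟦X⟧ c' p q) = if q = R.braid p then 1 else 0) :
    ∃ lam : I → I → Z × Z → K⟦X⟧,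
      (∀ i j z, constantCoeff (lam i j z) = if z = 1 then 1 else 0) ∧
      ∃ c, S.HasForm lam c ∧ YBEquivalent (Ideal.span {(X : K⟦X⟧)}) c c' := by
  have := Fintype.ofFinite Q
  have hT₀ : (LinearMap.toMatrix (basis2 Q K⟦X⟧) (basis2 Q K⟦X⟧) c').map
      (constantCoeff (R := K)) = permMat K R.braid := by
    ext q p
    rw [Matrix.map_apply, ← mat2_eq_toMatrix, hdef]
    rfl
  obtain ⟨a, lam, ha, hlam, hd⟩ := S.exists_gaugeDefect_eq_zero ((YBE_iff_matYBE c').1 hc') hT₀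
  let b : Module.Basis Q K⟦X⟧ (Q →₀ K⟦X⟧) := Finsupp.basisSingleOne
  have hau : IsUnit a.det := by
    rw [← Matrix.isUnit_iff_isUnit_det, isUnit_matrix_iff_map_constantCoeff, ha]
    exact isUnit_one
  obtain ⟨c, hc⟩ := (LinearMap.toMatrix (basis2 Q K⟦X⟧) (basis2 Q K⟦X⟧)).surjective
    (S.centralMatrix lam)
  let α := Matrix.toLinearEquiv b a hau
  have hα : LinearMap.toMatrix b b α.toLinearMap = a := by
    exact LinearMap.toMatrix_toLin b b a
  have hαα : LinearMap.toMatrix (basis2 Q K⟦X⟧) (basis2 Q K⟦X⟧)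
      (TensorProduct.congr α α).toLinearMap = a ⊗ₖ a := by
    have := TensorProduct.toMatrix_map b b b b α.toLinearMap α.toLinearMap
    rw [hα] at this
    exact this
  refine ⟨lam, hlam, c, (S.hasForm_iff lam c).2 hc, α, ?_, ?_⟩
  · intro x u
    have h : (α (Finsupp.single x 1)) u = a u x := by
      have := congrFun (congrFun hα u) x
      rw [LinearMap.toMatrix_apply] at this
      simpa [b] using this
    rw [h, Ideal.mem_span_singleton, X_dvd_iff, map_sub, sub_eq_zero]
    have := congrFun (congrFun ha u) x
    rw [Matrix.map_apply] at this
    rw [this, Matrix.one_apply]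
    by_cases hx : x = u
    · simp [hx]
    · simp [hx, Ne.symm hx]
  · have h : c' ∘ₗ (TensorProduct.congr α α).toLinearMap
        = (TensorProduct.congr α α).toLinearMap ∘ₗ c := by
      apply (LinearMap.toMatrix (basis2 Q K⟦X⟧) (basis2 Q K⟦X⟧)).injective
      rw [LinearMap.toMatrix_comp _ (basis2 Q K⟦X⟧), LinearMap.toMatrix_comp _ (basis2 Q K⟦X⟧),
        hαα, hc]
      exact sub_eq_zero.1 hd
    rw [← LinearMap.comp_assoc, ← h, LinearMap.comp_assoc]
    refine LinearMap.ext fun w => ?_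
    simp only [LinearMap.comp_apply, LinearEquiv.coe_coe, LinearEquiv.apply_symm_apply]

end Operators

end CentralAction

section ConjugacyClasses

variable {G : Type*} [Group G] {Q : Set G} {R : YBRack Q}

/-- Conjugation by any group element is an inner automorphism of a generating conjugation rack. -/
lemma exists_mem_Inn_conj (hgen : Subgroup.closure Q = ⊤)
    (hR : ∀ x y : Q, ((R.act x y : G)) = (y : G)⁻¹ * (x : G) * (y : G)) (g : G) :
    ∃ s ∈ R.Inn, ∀ x : Q, (s x : G) = g⁻¹ * (x : G) * g := by
  have hg : g ∈ Subgroup.closure Q := hgen ▸ Subgroup.mem_top g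
  induction hg using Subgroup.closure_induction with
  | mem y hy =>
    exact ⟨R.rho ⟨y, hy⟩, Subgroup.subset_closure ⟨_, rfl⟩, fun x => hR x ⟨y, hy⟩⟩
  | one => exact ⟨1, R.Inn.one_mem, fun x => by simp⟩
  | mul g h _ _ ihg ihh =>
    obtain ⟨s, hs, hsx⟩ := ihg
    obtain ⟨t, ht, htx⟩ := ihh
    refine ⟨t * s, R.Inn.mul_mem ht hs, fun x => ?_⟩
    rw [Equiv.Perm.mul_apply, htx, hsx]
    group
  | inv g _ ihg =>
    obtain ⟨s, hs, hsx⟩ := ihg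
    refine ⟨s⁻¹, R.Inn.inv_mem hs, fun x => ?_⟩
    have h := hsx (s⁻¹ x)
    rw [show s (s⁻¹ x) = x from s.apply_symm_apply x] at h
    rw [h]
    group

/-- Behaviourally equivalent elements of a generating conjugation rack differ by a central
factor. -/
lemma mul_inv_mem_center_of_bEquiv (hgen : Subgroup.closure Q = ⊤)
    (hR : ∀ x y : Q, ((R.act x y : G)) = (y : G)⁻¹ * (x : G) * (y : G)) {x u : Q}
    (h : R.BEquiv x u) : (u : G) * (x : G)⁻¹ ∈ Subgroup.center G := by
  rw [← Subgroup.centralizer_univ, ← Subgroup.coe_top, ← hgen, Subgroup.centralizer_closure]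
  rw [Subgroup.mem_centralizer_iff]
  intro a ha
  have h1 : (x : G)⁻¹ * a * x = (u : G)⁻¹ * a * u := by
    rw [← hR ⟨a, ha⟩ x, ← hR ⟨a, ha⟩ u, R.bEquiv_iff.1 h]
  calc a * (u * (x : G)⁻¹) = u * ((u : G)⁻¹ * a * u) * (x : G)⁻¹ := by group
    _ = u * (x : G)⁻¹ * a := by rw [← h1]; group

/-- The centre of a group acts on a union of conjugacy classes stable under multiplication by
central elements. -/
lemma exists_centralAction {n : ℕ} {Qs : Fin n → Set G}
    (hcc : ∀ i, ∃ g : G, Qs i = {x | IsConj g x})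
    (hdist : Function.Injective Qs) (hQ : Q = ⋃ i, Qs i)
    (hgen : Subgroup.closure Q = ⊤)
    (hZQ : ∀ (i : Fin n) (z : Subgroup.center G), ∀ x ∈ Qs i, (z : G) * x ∈ Qs i)
    (hR : ∀ x y : Q, ((R.act x y : G)) = (y : G)⁻¹ * (x : G) * (y : G)) :
    ∃ S : CentralAction R (Subgroup.center G) (Fin n),
      (∀ z x, (S.zm z x : G) = z * x) ∧ ∀ i (x : Q), S.cls x = i ↔ (x : G) ∈ Qs i := by
  have hcover : ∀ x : Q, ∃ i, (x : G) ∈ Qs i := fun x => by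
    simpa [hQ] using x.2
  have hsub : ∀ i, Qs i ⊆ Q := fun i => by
    rw [hQ]
    exact Set.subset_iUnion Qs i
  have hconj : ∀ i x y, x ∈ Qs i → (y ∈ Qs i ↔ IsConj x y) := by
    intro i x y hx
    obtain ⟨g, hg⟩ := hcc i
    rw [hg] at hx ⊢
    exact ⟨fun hy => hx.symm.trans hy, fun hy => hx.trans hy⟩
  have huniq : ∀ i j x, x ∈ Qs i → x ∈ Qs j → i = j := by
    intro i j x hi hj
    apply hdist
    ext y
    rw [hconj i x y hi, hconj j x y hj]
  choose cls hcls using hcover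
  have hclsi : ∀ i (x : Q), cls x = i ↔ (x : G) ∈ Qs i :=
    fun i x => ⟨fun h => h ▸ hcls x, fun h => huniq _ _ _ (hcls x) h⟩
  have hcomm : ∀ (z : Subgroup.center G) (g : G), g * z = z * g := fun z =>
    Subgroup.mem_center_iff.1 z.2
  refine ⟨
    { zm := fun z x => ⟨z * x, hsub _ (hZQ _ z x (hcls x))⟩
      cls := cls
      one_zm := fun x => Subtype.ext (one_mul _)
      zm_comm := fun a b x => Subtype.ext <| by
        change (a : G) * (b * x) = b * (a * x)
        rw [← mul_assoc, ← mul_assoc, hcomm]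
      act_zm_left := fun z x y => Subtype.ext <| by
        rw [hR]
        change (y : G)⁻¹ * (z * x) * y = z * (R.act x y)
        rw [hR, ← mul_assoc, hcomm z, ← mul_assoc, ← mul_assoc]
      act_zm_right := fun z x y => Subtype.ext <| by
        rw [hR, hR]
        change ((z : G) * y)⁻¹ * x * (z * y) = _
        rw [← mul_assoc, mul_assoc _ (x : G), hcomm z]
        group
      cls_zm := fun z x => (hclsi _ _).2 (hZQ _ z x (hcls x))
      cls_act := fun x y => (hclsi _ _).2 <| by
        rw [hR]
        exact conjClass_conj_mem (hcc _) (hcls x) y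
      zm_inj := fun a b x h => Subtype.ext (mul_right_cancel (congrArg Subtype.val h))
      exists_zm := fun x u h => ⟨⟨_, mul_inv_mem_center_of_bEquiv hgen hR h⟩,
        Subtype.ext (inv_mul_cancel_right (u : G) (x : G)).symm⟩
      cls_surjective := fun i => by
        obtain ⟨g, hg⟩ := hcc i
        have hgi : g ∈ Qs i := by
          rw [hg]
          exact IsConj.refl g
        exact ⟨⟨g, hsub i hgi⟩, (hclsi _ _).2 hgi⟩
      exists_mem_Inn := fun x x' h => by
        obtain ⟨g, hg⟩ := isConj_iff.1 ((hconj _ _ _ (hcls x)).1 ((hclsi _ _).1 h.symm))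
        obtain ⟨s, hs, hsx⟩ := exists_mem_Inn_conj hgen hR g⁻¹
        exact ⟨s, hs, Subtype.ext (by rw [hsx, inv_inv, hg])⟩ }, fun _ _ => rfl, hclsi⟩

end ConjugacyClasses

open scoped Classical in
/-- (Corollary on central deformations.) Let `G` be a finite group
with centre `Z`, generated by a union `Q` of distinct conjugacy classes
`Q₁, …, Q_n` with `Z·Q_i = Q_i`.  Over `ℚ⟦h⟧` with `m = (h)`:
(i) every Yang–Baxter deformation of `c_Q` is equivalent to one of the form
`c(x ⊗ y) = Σ_{(z,z')∈Z×Z} λ_{ij}(z,z') · (zy) ⊗ (z'·y⁻¹xy)` for `x ∈ Q_i`,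
`y ∈ Q_j`, with `λ_{ij}(1,1) ≡ 1` and `λ_{ij}(z,z') ≡ 0` otherwise mod `(h)`;
(ii) conversely every map of this form is a Yang–Baxter operator. -/
theorem central_deformations
    {G : Type*} [Group G] [Fintype G] {n : ℕ}
    (Qs : Fin n → Set G)
    (hcc : ∀ i, ∃ g : G, Qs i = {x | IsConj g x})
    (hdist : Function.Injective Qs)
    (Q : Set G) (hQ : Q = ⋃ i, Qs i)
    (hgen : Subgroup.closure Q = ⊤)
    (hZQ : ∀ (i : Fin n) (z : Subgroup.center G), ∀ x ∈ Qs i, (z : G) * x ∈ Qs i)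
    (R : YBRack Q) (hR : ∀ x y : Q, ((R.act x y : G)) = (y : G)⁻¹ * (x : G) * (y : G))
    (cQ : ((Q →₀ PowerSeries ℚ) ⊗[PowerSeries ℚ] (Q →₀ PowerSeries ℚ)) →ₗ[PowerSeries ℚ]
      ((Q →₀ PowerSeries ℚ) ⊗[PowerSeries ℚ] (Q →₀ PowerSeries ℚ)))
    (hcQ : ∀ x y : Q,
      cQ (Finsupp.single x (1 : PowerSeries ℚ) ⊗ₜ[PowerSeries ℚ]
            Finsupp.single y (1 : PowerSeries ℚ))
        = Finsupp.single y (1 : PowerSeries ℚ) ⊗ₜ[PowerSeries ℚ]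
            Finsupp.single (R.act x y) (1 : PowerSeries ℚ)) :
    (∀ ctilde : ((Q →₀ PowerSeries ℚ) ⊗[PowerSeries ℚ] (Q →₀ PowerSeries ℚ)) →ₗ[PowerSeries ℚ]
        ((Q →₀ PowerSeries ℚ) ⊗[PowerSeries ℚ] (Q →₀ PowerSeries ℚ)),
      IsYBOp ctilde →
      (∀ p q : Q × Q, mat2 (PowerSeries ℚ) ctilde p q - mat2 (PowerSeries ℚ) cQ p q
          ∈ Ideal.span {(PowerSeries.X : PowerSeries ℚ)}) →
      ∃ lam : Fin n → Fin n → (Subgroup.center G × Subgroup.center G) → PowerSeries ℚ,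
        (∀ i j, lam i j 1 - 1 ∈ Ideal.span {(PowerSeries.X : PowerSeries ℚ)}) ∧
        (∀ i j z, z ≠ 1 → lam i j z ∈ Ideal.span {(PowerSeries.X : PowerSeries ℚ)}) ∧
        ∃ c : ((Q →₀ PowerSeries ℚ) ⊗[PowerSeries ℚ] (Q →₀ PowerSeries ℚ)) →ₗ[PowerSeries ℚ]
            ((Q →₀ PowerSeries ℚ) ⊗[PowerSeries ℚ] (Q →₀ PowerSeries ℚ)),
          (∀ (i j : Fin n) (x y : Q) (hx : (x : G) ∈ Qs i) (hy : (y : G) ∈ Qs j),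
            c (Finsupp.single x (1 : PowerSeries ℚ) ⊗ₜ[PowerSeries ℚ]
                Finsupp.single y (1 : PowerSeries ℚ))
              = ∑ z : Subgroup.center G × Subgroup.center G, lam i j z •
                  (Finsupp.single (⟨(z.1 : G) * (y : G), by
                      have hsub : Qs j ⊆ Q := by rw [hQ]; exact Set.subset_iUnion Qs j
                      exact hsub (hZQ j z.1 _ hy)⟩ : Q)
                      (1 : PowerSeries ℚ) ⊗ₜ[PowerSeries ℚ]
                    Finsupp.single (⟨(z.2 : G) * ((R.act x y : Q) : G), by
                      have hsub : Qs i ⊆ Q := by rw [hQ]; exact Set.subset_iUnion Qs i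
                      refine hsub (hZQ i z.2 _ ?_)
                      rw [hR]
                      exact conjClass_conj_mem (hcc i) hx (y : G)⟩ : Q)
                      (1 : PowerSeries ℚ))) ∧
          YBEquivalent (Ideal.span {(PowerSeries.X : PowerSeries ℚ)}) c ctilde) ∧
    (∀ lam : Fin n → Fin n → (Subgroup.center G × Subgroup.center G) → PowerSeries ℚ,
      (∀ i j, lam i j 1 - 1 ∈ Ideal.span {(PowerSeries.X : PowerSeries ℚ)}) →
      (∀ i j z, z ≠ 1 → lam i j z ∈ Ideal.span {(PowerSeries.X : PowerSeries ℚ)}) →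
      ∀ c : ((Q →₀ PowerSeries ℚ) ⊗[PowerSeries ℚ] (Q →₀ PowerSeries ℚ)) →ₗ[PowerSeries ℚ]
          ((Q →₀ PowerSeries ℚ) ⊗[PowerSeries ℚ] (Q →₀ PowerSeries ℚ)),
        (∀ (i j : Fin n) (x y : Q) (hx : (x : G) ∈ Qs i) (hy : (y : G) ∈ Qs j),
          c (Finsupp.single x (1 : PowerSeries ℚ) ⊗ₜ[PowerSeries ℚ]
              Finsupp.single y (1 : PowerSeries ℚ))
            = ∑ z : Subgroup.center G × Subgroup.center G, lam i j z •
                (Finsupp.single (⟨(z.1 : G) * (y : G), by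
                    have hsub : Qs j ⊆ Q := by rw [hQ]; exact Set.subset_iUnion Qs j
                    exact hsub (hZQ j z.1 _ hy)⟩ : Q)
                    (1 : PowerSeries ℚ) ⊗ₜ[PowerSeries ℚ]
                  Finsupp.single (⟨(z.2 : G) * ((R.act x y : Q) : G), by
                    have hsub : Qs i ⊆ Q := by rw [hQ]; exact Set.subset_iUnion Qs i
                    refine hsub (hZQ i z.2 _ ?_)
                    rw [hR]
                    exact conjClass_conj_mem (hcc i) hx (y : G)⟩ : Q)
                    (1 : PowerSeries ℚ))) →
        IsYBOp c) := by
  obtain ⟨S, hzm, hcls⟩ := exists_centralAction hcc hdist hQ hgen hZQ hR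
  have hspan : ∀ f g : PowerSeries ℚ, f - g ∈ Ideal.span {(PowerSeries.X : PowerSeries ℚ)} ↔
      PowerSeries.constantCoeff f = PowerSeries.constantCoeff g := by
    intro f g
    rw [Ideal.mem_span_singleton, PowerSeries.X_dvd_iff, map_sub, sub_eq_zero]
  have hlam : ∀ lam : Fin n → Fin n → (Subgroup.center G × Subgroup.center G) → PowerSeries ℚ,
      (∀ i j z, PowerSeries.constantCoeff (lam i j z) = if z = 1 then 1 else 0) ↔
      (∀ i j, lam i j 1 - 1 ∈ Ideal.span {(PowerSeries.X : PowerSeries ℚ)}) ∧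
        (∀ i j z, z ≠ 1 → lam i j z ∈ Ideal.span {(PowerSeries.X : PowerSeries ℚ)}) := by
    intro lam
    constructor
    · refine fun h => ⟨fun i j => ?_, fun i j z hz => ?_⟩
      · rw [hspan, h, if_pos rfl, map_one]
      · rw [← sub_zero (lam i j z), hspan, h, if_neg hz, map_zero]
    · rintro ⟨h1, h2⟩ i j z
      by_cases hz : z = 1
      · rw [if_pos hz, hz, (hspan _ _).1 (h1 i j), map_one]
      · have h := h2 i j z hz
        rw [← sub_zero (lam i j z), hspan, map_zero] at h
        rw [if_neg hz, h]
  have hzm' : ∀ (z : Subgroup.center G) (x : Q) (h : (z : G) * x ∈ Q),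
      (⟨(z : G) * x, h⟩ : Q) = S.zm z x := fun z x h => Subtype.ext (hzm z x).symm
  refine ⟨fun ctilde hct hdef => ?_, fun lam h1 h2 c hc => ?_⟩
  · have hdef' : ∀ p q, PowerSeries.constantCoeff (mat2 (PowerSeries ℚ) ctilde p q)
        = if q = R.braid p then 1 else 0 := by
      rintro ⟨x, y⟩ q
      rw [(hspan _ _).1 (hdef (x, y) q), mat2,
        finsuppTensorFinsupp'_symm_single_eq_single_one_tmul, hcQ,
        finsuppTensorFinsupp'_single_tmul_single, Finsupp.single_apply, one_mul, R.braid_apply]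
      simp only [eq_comm (a := q), apply_ite PowerSeries.constantCoeff, map_one, map_zero]
    obtain ⟨lam, hl, c, hc, heq⟩ := S.exists_hasForm_equivalent hct.2 (by convert hdef')
    have hl' := (hlam lam).1 (by convert hl)
    refine ⟨lam, hl'.1, hl'.2, c, fun i j x y hx hy => ?_, heq⟩
    rw [hc x y, (hcls i x).2 hx, (hcls j y).2 hy]
    simp only [hzm']
  · have hl := (hlam lam).2 ⟨h1, h2⟩
    refine CentralAction.HasForm.isYBOp (S := S) (lam := lam) (fun x y => ?_) (by convert hl)
    rw [hc (S.cls x) (S.cls y) x y ((hcls _ _).1 rfl) ((hcls _ _).1 rfl)]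
    simp only [hzm']

end
end

section
/- Let Q be a rack, n ≥ 1 an integer, A = (ℤ/nℤ)[h]/(h²), and α: Q × Q → ℤ/nℤ a function. Define the A-linear map c: AQ² → AQ² by c(x ⊗ y) = (1 + h·α(x,y)) · (y ⊗ x^y) for x,y ∈ Q. Then c is a Yang-Baxter operator if and only if α(x,y) + α(x^y,z) = α(x,z) + α(x^z,y^z) for all x,y,z ∈ Q (i.e., α is an additive rack 2-cocycle). -/
open TensorProduct

noncomputable section

open Finsupp in
/-- A linear map `x ⊗ y ↦ u x y • (y ⊗ x ^ y)` with unit coefficients is bijective. -/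
theorem bijective_of_diagonal {Q A : Type*} [CommRing A] (R : YBRack Q) (u : Q → Q → Aˣ)
    (c : ((Q →₀ A) ⊗[A] (Q →₀ A)) →ₗ[A] ((Q →₀ A) ⊗[A] (Q →₀ A)))
    (hc : ∀ x y : Q, c (single x 1 ⊗ₜ[A] single y 1)
      = (u x y : A) • (single y 1 ⊗ₜ[A] single (R.act x y) 1)) :
    Function.Bijective c := by
  let σ : Q × Q ≃ Q × Q := Equiv.ofBijective (fun p => (p.2, R.act p.1 p.2)) <| by
    constructor
    · rintro ⟨x, y⟩ ⟨x', y'⟩ h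
      obtain ⟨rfl, h⟩ := Prod.mk.inj h
      exact Prod.ext ((R.act_bijective _).1 h) rfl
    · rintro ⟨y, z⟩
      obtain ⟨x, hx⟩ := (R.act_bijective y).2 z
      exact ⟨(x, y), Prod.ext rfl hx⟩
  let B := (Finsupp.basisSingleOne (R := A) (ι := Q)).tensorProduct
    (Finsupp.basisSingleOne (R := A) (ι := Q))
  let w : Q × Q → Aˣ := fun q => u (σ.symm q).1 (σ.symm q).2
  have hce : c = (B.equiv (B.unitsSMul w) σ).toLinearMap := by
    refine B.ext fun ⟨x, y⟩ => ?_
    have hσ : σ (x, y) = (y, R.act x y) := rfl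
    have hw : w (σ (x, y)) = u x y := by simp [w]
    rw [LinearEquiv.coe_coe, Module.Basis.equiv_apply, Module.Basis.unitsSMul_apply, hw, hσ]
    simp [B, hc, Units.smul_def]
  rw [hce]
  exact (B.equiv (B.unitsSMul w) σ).bijective

open Finsupp in
/-- The braid equation for `x ⊗ y ↦ u x y • (y ⊗ x ^ y)` with unit coefficients is the
multiplicative rack 2-cocycle condition on `u`. -/
theorem ybe_diagonal_iff {Q A : Type*} [CommRing A] (R : YBRack Q) (u : Q → Q → Aˣ)
    (c : ((Q →₀ A) ⊗[A] (Q →₀ A)) →ₗ[A] ((Q →₀ A) ⊗[A] (Q →₀ A)))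
    (hc : ∀ x y : Q, c (single x 1 ⊗ₜ[A] single y 1)
      = (u x y : A) • (single y 1 ⊗ₜ[A] single (R.act x y) 1)) :
    YBE c ↔ ∀ x y z : Q,
      u x y * u (R.act x y) z = u x z * u (R.act x z) (R.act y z) := by
  let b := Finsupp.basisSingleOne (R := A) (ι := Q)
  let B := (b.tensorProduct b).tensorProduct b
  have hB (x y z : Q) :
      B ((x, y), z) = (single x 1 ⊗ₜ[A] single y 1) ⊗ₜ[A] single z 1 := by simp [B, b]
  have key (x y z : Q) (s t : A) : s • B ((x, y), z) = t • B ((x, y), z) ↔ s = t := by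
    refine ⟨fun h => ?_, fun h => h ▸ rfl⟩
    simpa using congrArg (fun v => B.repr v ((x, y), z)) h
  have hYBE : YBE c ↔ ∀ x y z : Q,
      ((u x y : A) * u (R.act x y) z * u y z) • B ((z, R.act y z), R.act (R.act x y) z)
        = ((u x z : A) * u (R.act x z) (R.act y z) * u y z) •
          B ((z, R.act y z), R.act (R.act x y) z) := by
    have ext_iff (f g : ((Q →₀ A) ⊗[A] (Q →₀ A)) ⊗[A] (Q →₀ A) →ₗ[A]
        ((Q →₀ A) ⊗[A] (Q →₀ A)) ⊗[A] (Q →₀ A)) :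
        f = g ↔ ∀ x y z, f (B ((x, y), z)) = g (B ((x, y), z)) :=
      ⟨fun h _ _ _ => h ▸ rfl, fun h => B.ext fun ⟨⟨x, y⟩, z⟩ => h x y z⟩
    rw [YBE, ext_iff]
    refine forall_congr' fun x => forall_congr' fun y => forall_congr' fun z => ?_
    simp only [hB, LinearMap.comp_apply, LinearEquiv.coe_coe, LinearMap.rTensor_tmul,
      LinearMap.lTensor_tmul, TensorProduct.assoc_tmul, TensorProduct.assoc_symm_tmul, hc,
      map_smul, ← TensorProduct.smul_tmul', TensorProduct.tmul_smul, smul_smul,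
      R.self_distrib x y z]
    refine Eq.congr ?_ ?_
    · congr 1
    · congr 1
      ring
  simp only [hYBE, key, Units.mul_left_inj, Units.ext_iff, Units.val_mul]

theorem DualNumber.one_add_eps_mul_mul {S : Type*} [CommRing S] (a b : S) :
    (1 + eps * algebraMap S (DualNumber S) a) * (1 + eps * algebraMap S (DualNumber S) b)
      = 1 + eps * algebraMap S (DualNumber S) (a + b) := by
  rw [map_add]
  linear_combination (algebraMap S (DualNumber S) a * algebraMap S (DualNumber S) b) *
    DualNumber.eps_mul_eps (R := S)

/-- The unit `1 + ε a` of the dual numbers. -/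
def DualNumber.oneAddEpsUnit {S : Type*} [CommRing S] (a : S) : (DualNumber S)ˣ where
  val := 1 + eps * algebraMap S (DualNumber S) a
  inv := 1 + eps * algebraMap S (DualNumber S) (-a)
  val_inv := by rw [one_add_eps_mul_mul]; simp
  inv_val := by rw [one_add_eps_mul_mul]; simp

theorem DualNumber.oneAddEpsUnit_mul {S : Type*} [CommRing S] (a b : S) :
    oneAddEpsUnit a * oneAddEpsUnit b = oneAddEpsUnit (a + b) :=
  Units.ext (one_add_eps_mul_mul a b)

theorem DualNumber.oneAddEpsUnit_injective {S : Type*} [CommRing S] :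
    Function.Injective (oneAddEpsUnit (S := S)) := fun a b h => by
  simpa [oneAddEpsUnit, TrivSqZeroExt.algebraMap_eq_inl] using
    congrArg (fun v : (DualNumber S)ˣ => TrivSqZeroExt.snd (v : DualNumber S)) h

/-- (Diagonal deformations and rack cocycles.) Over the dual
numbers `A = (ℤ/nℤ)[h]/(h²)`, the map `c(x ⊗ y) = (1 + h·α(x,y)) · (y ⊗ x^y)` is
a Yang–Baxter operator iff `α` is an additive rack 2-cocycle. -/
theorem diagonal_deformation_iff_rack_cocycle
    {Q : Type*} (R : YBRack Q) (n : ℕ) (hn : 1 ≤ n)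
    (α : Q → Q → ZMod n)
    (c : ((Q →₀ DualNumber (ZMod n)) ⊗[DualNumber (ZMod n)] (Q →₀ DualNumber (ZMod n)))
      →ₗ[DualNumber (ZMod n)]
      ((Q →₀ DualNumber (ZMod n)) ⊗[DualNumber (ZMod n)] (Q →₀ DualNumber (ZMod n))))
    (hc : ∀ x y : Q,
      c (Finsupp.single x (1 : DualNumber (ZMod n)) ⊗ₜ[DualNumber (ZMod n)]
          Finsupp.single y (1 : DualNumber (ZMod n)))
        = (1 + DualNumber.eps * algebraMap (ZMod n) (DualNumber (ZMod n)) (α x y)) •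
            (Finsupp.single y (1 : DualNumber (ZMod n)) ⊗ₜ[DualNumber (ZMod n)]
              Finsupp.single (R.act x y) (1 : DualNumber (ZMod n)))) :
    IsYBOp c ↔
      (∀ x y z : Q, α x y + α (R.act x y) z = α x z + α (R.act x z) (R.act y z)) := by
  let u (x y : Q) := DualNumber.oneAddEpsUnit (α x y)
  rw [IsYBOp, and_iff_right (bijective_of_diagonal R u c hc), ybe_diagonal_iff R u c hc]
  simp only [u, DualNumber.oneAddEpsUnit_mul, DualNumber.oneAddEpsUnit_injective.eq_iff]

end
end

section
/- Let Q be a rack such that Inn(Q) acts transitively on Q and the map ϱ: Q → Bij(Q), y ↦ ϱ(y), is injective. Let A be a commutative ring and n ≥ 1. Then every entropic A-linear map f: AQ^n → AQ^n is a scalar multiple of the identity: there exists λ ∈ A with f = λ·id. -/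
open TensorProduct

noncomputable section

namespace YBRack

variable {Q : Type*} {A : Type*} [CommRing A]

/-- Iterated rack action by the elements of a list: `x ^ (z₁ z₂ ⋯ z_k)`. -/
def actList (R : YBRack Q) (x : Q) (l : List Q) : Q := l.foldl R.act x

open scoped Classical in
/-- The `i`-th partial coboundary operator `d_i` on matrices of `n`-cochains
(indices `0, …, n` correspond to the paper's `x_0, …, x_n`). -/
def dPart (R : YBRack Q) {n : ℕ} (f : (Fin n → Q) → (Fin n → Q) → A) (i : Fin (n+1))
    (x y : Fin (n+1) → Q) : A :=
  f (fun j => x (i.succAbove j)) (fun j => y (i.succAbove j)) *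
      (if R.actList (x i) ((List.ofFn x).drop ((i : ℕ)+1))
          = R.actList (y i) ((List.ofFn y).drop ((i : ℕ)+1)) then 1 else 0)
  - f (fun j => if (j : ℕ) < (i : ℕ) then R.act (x (i.succAbove j)) (x i) else x (i.succAbove j))
      (fun j => if (j : ℕ) < (i : ℕ) then R.act (y (i.succAbove j)) (y i) else y (i.succAbove j)) *
      (if x i = y i then 1 else 0)

/-- The full coboundary operator `d = Σ_{i=0}^{n} (-1)^i d_i`. -/
def dSum (R : YBRack Q) {n : ℕ} (f : (Fin n → Q) → (Fin n → Q) → A)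
    (x y : Fin (n+1) → Q) : A :=
  ∑ i : Fin (n+1), (-1 : A) ^ (i : ℕ) * R.dPart f i x y

/-- A matrix is quasi-diagonal if its entry vanishes as soon as some pair of
indices is not behaviourally equivalent. -/
def QuasiDiagonal (R : YBRack Q) {n : ℕ} (f : (Fin n → Q) → (Fin n → Q) → A) : Prop :=
  ∀ x y : Fin n → Q, (∃ i : Fin n, ¬ R.BEquiv (x i) (y i)) → f x y = 0

/-- A matrix is fully equivariant if it is invariant under the coordinatewise
action of `Inn(Q)^n`. -/
def FullyEquivariant (R : YBRack Q) {n : ℕ} (f : (Fin n → Q) → (Fin n → Q) → A) : Prop :=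
  ∀ (x y : Fin n → Q) (α : Fin n → R.Inn),
    f (fun i => (α i : Equiv.Perm Q) (x i)) (fun i => (α i : Equiv.Perm Q) (y i)) = f x y

end YBRack

open scoped Classical in
/-- If `Inn(Q)` acts transitively on `Q` and `ϱ : Q → Perm Q` is
injective, then every entropic matrix is a scalar multiple of the identity. -/
theorem entropic_of_transitive_faithful_is_scalar
    {A Q : Type*} [CommRing A] (R : YBRack Q)
    (htrans : ∀ x y : Q, ∃ α : R.Inn, (α : Equiv.Perm Q) x = y)
    (hinj : Function.Injective R.rho)
    {n : ℕ} (hn : 1 ≤ n) (f : (Fin n → Q) → (Fin n → Q) → A)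
    (hqd : R.QuasiDiagonal f) (heqv : R.FullyEquivariant f) :
    ∃ lam : A, ∀ x y : Fin n → Q, f x y = if x = y then lam else 0 := by
  rcases isEmpty_or_nonempty (Fin n → Q) with _ | ⟨⟨a⟩⟩
  · exact ⟨0, fun x => isEmptyElim x⟩
  · refine ⟨f a a, fun x y => ?_⟩
    split_ifs with h
    · subst h
      choose α hα using fun i => htrans (a i) (x i)
      simpa only [hα] using heqv a a α
    · obtain ⟨i, hi⟩ := Function.ne_iff.mp h
      exact hqd x y ⟨i, fun e => hi (hinj e)⟩

end
end
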